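/- arXiv:math/0506288 — 2 statements merged into one kernel-verified Lean document; each statement's English description precedes it below -/
import Mathlib

section
/- Let l = l(n) be a sequence of positive integers such that l(n) → ∞ and ln n / ln l(n) → ∞ as n → ∞. Then for every ε > 0 and all sufficiently large n, D^tree_0(n, l(n)) ≤ (1 + ε) · l(n) · ln n / ln l(n). -/
namespace FODef

/-- A graph colored with `K` unary predicates. -/
structure CGraph (K : ℕ) (V : Type) where
  graph : SimpleGraph V
  color : Fin K → V → Prop

/-- First-order formulas in the language of graphs with `K` unary color predicates,
with free variables among `x_0, …, x_{n-1}`. -/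
inductive CForm (K : ℕ) : ℕ → Type
  | adj {n : ℕ} (i j : Fin n) : CForm K n
  | eq {n : ℕ} (i j : Fin n) : CForm K n
  | col {n : ℕ} (c : Fin K) (i : Fin n) : CForm K n
  | neg {n : ℕ} : CForm K n → CForm K n
  | conj {n : ℕ} : CForm K n → CForm K n → CForm K n
  | disj {n : ℕ} : CForm K n → CForm K n → CForm K n
  | ex {n : ℕ} : CForm K (n + 1) → CForm K n
  | fa {n : ℕ} : CForm K (n + 1) → CForm K n

/-- Realization of a formula in a colored graph, under a valuation of the free variables. -/
def CForm.Realize {K : ℕ} {V : Type} (C : CGraph K V) :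
    ∀ {n : ℕ}, CForm K n → (Fin n → V) → Prop
  | _, .adj i j, f => C.graph.Adj (f i) (f j)
  | _, .eq i j, f => f i = f j
  | _, .col c i, f => C.color c (f i)
  | _, .neg φ, f => ¬ CForm.Realize C φ f
  | _, .conj φ ψ, f => CForm.Realize C φ f ∧ CForm.Realize C ψ f
  | _, .disj φ ψ, f => CForm.Realize C φ f ∨ CForm.Realize C ψ f
  | _, .ex φ, f => ∃ v : V, CForm.Realize C φ (Fin.snoc f v)
  | _, .fa φ, f => ∀ v : V, CForm.Realize C φ (Fin.snoc f v)

/-- Quantifier depth: the maximum number of nested quantifiers. -/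
def CForm.depth {K : ℕ} : ∀ {n : ℕ}, CForm K n → ℕ
  | _, .adj _ _ => 0
  | _, .eq _ _ => 0
  | _, .col _ _ => 0
  | _, .neg φ => φ.depth
  | _, .conj φ ψ => max φ.depth ψ.depth
  | _, .disj φ ψ => max φ.depth ψ.depth
  | _, .ex φ => φ.depth + 1
  | _, .fa φ => φ.depth + 1

/-- Isomorphism of colored graphs: a graph isomorphism preserving all colors. -/
def CIso {K : ℕ} {V W : Type} (C : CGraph K V) (C' : CGraph K W) : Prop :=
  ∃ e : V ≃ W, (∀ v w : V, C.graph.Adj v w ↔ C'.graph.Adj (e v) (e w)) ∧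
    ∀ (c : Fin K) (v : V), C.color c v ↔ C'.color c (e v)

/-- A sentence (formula with no free variables) holds in a colored graph. -/
def CSat {K : ℕ} {V : Type} (C : CGraph K V) (φ : CForm K 0) : Prop :=
  φ.Realize C ![]

/-- A sentence defines a colored graph `C` if `C` satisfies it and every finite colored
graph (in the same language) satisfying it is isomorphic to `C`. -/
def CDefines {K : ℕ} {V : Type} (C : CGraph K V) (φ : CForm K 0) : Prop :=
  CSat C φ ∧ ∀ (m : ℕ) (C' : CGraph K (Fin m)), CSat C' φ → CIso C C'

/-- Minimum quantifier depth of a first-order sentence defining a colored graph. -/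
noncomputable def Dcol {K : ℕ} {V : Type} (C : CGraph K V) : ℕ :=
  sInf {d | ∃ φ : CForm K 0, φ.depth = d ∧ CDefines C φ}

/-- A colored tree: the underlying graph is connected and acyclic. -/
def IsColTree {K : ℕ} {V : Type} (C : CGraph K V) : Prop :=
  C.graph.Connected ∧ C.graph.IsAcyclic

/-- Degree of a vertex. -/
noncomputable def deg {V : Type} (G : SimpleGraph V) (v : V) : ℕ :=
  Nat.card {w // G.Adj v w}

/-- `Dtree n l`: the maximum of `Dcol T` over all colored trees `T` with at most `n`
vertices and maximum degree at most `l` (with any finite number of colors). -/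
noncomputable def Dtree (n l : ℕ) : ℕ :=
  sSup {d | ∃ (K m : ℕ) (C : CGraph K (Fin m)), IsColTree C ∧ m ≤ n ∧
    (∀ v, deg C.graph v ≤ l) ∧ d = Dcol C}

/-- An uncolored graph, viewed as a colored graph with no colors.  A sentence of the
pure graph language defines it iff it `CDefines` it, and `CIso` for such graphs is plain
graph isomorphism, so `Dcol (plain G)` is the minimum quantifier depth `D(G)` of a
first-order sentence defining the (uncolored) graph `G`. -/
def plain {V : Type} (G : SimpleGraph V) : CGraph 0 V :=
  ⟨G, fun c _ => c.elim0⟩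

end FODef

namespace FODef

/-- Quantifier-free formulas. -/
def CForm.qfree {K : ℕ} : ∀ {n : ℕ}, CForm K n → Prop
  | _, .adj _ _ => True
  | _, .eq _ _ => True
  | _, .col _ _ => True
  | _, .neg φ => φ.qfree
  | _, .conj φ ψ => φ.qfree ∧ ψ.qfree
  | _, .disj φ ψ => φ.qfree ∧ ψ.qfree
  | _, .ex _ => False
  | _, .fa _ => False

/-- No quantifier occurs within the scope of a negation sign. -/
def CForm.negQF {K : ℕ} : ∀ {n : ℕ}, CForm K n → Prop
  | _, .adj _ _ => True
  | _, .eq _ _ => True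
  | _, .col _ _ => True
  | _, .neg φ => φ.qfree
  | _, .conj φ ψ => φ.negQF ∧ ψ.negQF
  | _, .disj φ ψ => φ.negQF ∧ ψ.negQF
  | _, .ex φ => φ.negQF
  | _, .fa φ => φ.negQF

/-- Auxiliary function computing the maximum number of changes between `∃` and `∀` along
chains of nested quantifiers; the extra argument records the kind of the innermost
quantifier lying above (`some true` = `∃`, `some false` = `∀`, `none` = no quantifier above). -/
def CForm.altAux {K : ℕ} : ∀ {n : ℕ}, CForm K n → Option Bool → ℕ
  | _, .adj _ _, _ => 0
  | _, .eq _ _, _ => 0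
  | _, .col _ _, _ => 0
  | _, .neg φ, b => φ.altAux b
  | _, .conj φ ψ, b => max (φ.altAux b) (ψ.altAux b)
  | _, .disj φ ψ, b => max (φ.altAux b) (ψ.altAux b)
  | _, .ex φ, b => φ.altAux (some true) + (if b = some false then 1 else 0)
  | _, .fa φ, b => φ.altAux (some false) + (if b = some true then 1 else 0)

/-- The alternation number of a formula (with no quantifier in the scope of a negation):
the maximum number of changes between `∃` and `∀` along a chain of nested quantifiers. -/
def CForm.altNum {K n : ℕ} (φ : CForm K n) : ℕ := φ.altAux none

/-- Minimum quantifier depth of a defining sentence of alternation number at most `r`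
(with no quantifier in the scope of a negation sign). -/
noncomputable def Dcol_alt (r : ℕ) {K : ℕ} {V : Type} (C : CGraph K V) : ℕ :=
  sInf {d | ∃ φ : CForm K 0, φ.negQF ∧ φ.altNum ≤ r ∧ φ.depth = d ∧ CDefines C φ}

/-- `Dtree_alt r n l`: the maximum of `Dcol_alt r T` over all colored trees `T` with at
most `n` vertices and maximum degree at most `l`. -/
noncomputable def Dtree_alt (r n l : ℕ) : ℕ :=
  sSup {d | ∃ (K m : ℕ) (C : CGraph K (Fin m)), IsColTree C ∧ m ≤ n ∧
    (∀ v, deg C.graph v ≤ l) ∧ d = Dcol_alt r C}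

end FODef

open Filter FODef

namespace FODef

open SimpleGraph

/-- Formulas built from quantifier-free ones by conjunction and existential quantification. -/
inductive IsEx {K : ℕ} : ∀ {n : ℕ}, CForm K n → Prop
  | qf {n : ℕ} {φ : CForm K n} : φ.qfree → IsEx φ
  | conj {n : ℕ} {φ ψ : CForm K n} : IsEx φ → IsEx ψ → IsEx (.conj φ ψ)
  | ex {n : ℕ} {φ : CForm K (n + 1)} : IsEx φ → IsEx (.ex φ)

section Formulas

variable {K n : ℕ}

theorem CForm.qfree.negQF {φ : CForm K n} (h : φ.qfree) : φ.negQF := by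
  induction φ <;> simp_all [CForm.qfree, CForm.negQF]

theorem CForm.qfree.altAux {φ : CForm K n} (h : φ.qfree) (b : Option Bool) :
    φ.altAux b = 0 := by
  induction φ <;> simp_all [CForm.qfree, CForm.altAux]

theorem CForm.qfree.depth {φ : CForm K n} (h : φ.qfree) : φ.depth = 0 := by
  induction φ <;> simp_all [CForm.qfree, CForm.depth]

theorem IsEx.negQF {φ : CForm K n} (h : IsEx φ) : φ.negQF := by
  induction h with
  | qf h => exact h.negQF
  | conj _ _ h₁ h₂ => exact ⟨h₁, h₂⟩
  | ex _ h => exact h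

theorem IsEx.altAux {φ : CForm K n} (h : IsEx φ) {b : Option Bool} (hb : b ≠ some false) :
    φ.altAux b = 0 := by
  induction h generalizing b with
  | qf h => exact h.altAux b
  | conj _ _ h₁ h₂ => simp [CForm.altAux, h₁ hb, h₂ hb]
  | ex _ h => simp [CForm.altAux, hb, h]

/-- The negation of an existential formula is equivalent to a universal formula of the same
quantifier depth. -/
theorem IsEx.exists_dual {φ : CForm K n} (h : IsEx φ) :
    ∃ ψ : CForm K n, ψ.negQF ∧ (∀ b, b ≠ some true → ψ.altAux b = 0) ∧ ψ.depth = φ.depth ∧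
      ∀ (V : Type) (C : CGraph K V) (f : Fin n → V), ψ.Realize C f ↔ ¬ φ.Realize C f := by
  induction h with
  | @qf _ φ h =>
    exact ⟨.neg φ, h, fun b _ => h.altAux b, rfl, fun _ _ _ => Iff.rfl⟩
  | conj _ _ h₁ h₂ =>
    obtain ⟨ψ₁, a₁, b₁, c₁, d₁⟩ := h₁
    obtain ⟨ψ₂, a₂, b₂, c₂, d₂⟩ := h₂
    refine ⟨.disj ψ₁ ψ₂, ⟨a₁, a₂⟩, fun b hb => ?_, ?_, fun V C f => ?_⟩
    · simp [CForm.altAux, b₁ b hb, b₂ b hb]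
    · simp [CForm.depth, c₁, c₂]
    · simp only [CForm.Realize, d₁, d₂]
      tauto
  | ex _ h =>
    obtain ⟨ψ, a, b, c, d⟩ := h
    refine ⟨.fa ψ, a, fun b' hb => ?_, ?_, fun V C f => ?_⟩
    · simp [CForm.altAux, hb, b]
    · simp [CForm.depth, c]
    · simp [CForm.Realize, d]

end Formulas

/-- A property of `n`-tuples in colored graphs is existentially definable in depth `d`. -/
def ExDef (K n : ℕ) (d : ℝ) (P : ∀ V : Type, CGraph K V → (Fin n → V) → Prop) : Prop :=
  ∃ φ : CForm K n, IsEx φ ∧ (φ.depth : ℝ) ≤ d ∧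
    ∀ (V : Type) (C : CGraph K V) (f : Fin n → V), φ.Realize C f ↔ P V C f

namespace ExDef

variable {K n : ℕ} {d e : ℝ} {P Q : ∀ V : Type, CGraph K V → (Fin n → V) → Prop}

theorem mono (h : ExDef K n d P) (hde : d ≤ e) : ExDef K n e P := by
  obtain ⟨φ, h₁, h₂, h₃⟩ := h
  exact ⟨φ, h₁, h₂.trans hde, h₃⟩

theorem congr (h : ExDef K n d P) (hPQ : ∀ V C f, P V C f ↔ Q V C f) : ExDef K n d Q := by
  obtain ⟨φ, h₁, h₂, h₃⟩ := h
  exact ⟨φ, h₁, h₂, fun V C f => (h₃ V C f).trans (hPQ V C f)⟩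

theorem and (hP : ExDef K n d P) (hQ : ExDef K n d Q) :
    ExDef K n d (fun V C f => P V C f ∧ Q V C f) := by
  obtain ⟨φ, h₁, h₂, h₃⟩ := hP
  obtain ⟨ψ, g₁, g₂, g₃⟩ := hQ
  refine ⟨.conj φ ψ, .conj h₁ g₁, ?_, fun V C f => ?_⟩
  · simp [CForm.depth, h₂, g₂]
  · simp [CForm.Realize, h₃, g₃]

theorem exists_snoc {R : ∀ V : Type, CGraph K V → (Fin (n + 1) → V) → Prop}
    (h : ExDef K (n + 1) d R) :
    ExDef K n (d + 1) (fun V C f => ∃ x : V, R V C (Fin.snoc f x)) := by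
  obtain ⟨φ, h₁, h₂, h₃⟩ := h
  refine ⟨.ex φ, .ex h₁, ?_, fun V C f => ?_⟩
  · simpa [CForm.depth] using h₂
  · simp [CForm.Realize, h₃]

theorem of_qfree (φ : CForm K n) (h : φ.qfree) (hd : 0 ≤ d) :
    ExDef K n d (fun _ C f => φ.Realize C f) :=
  ⟨φ, .qf h, by simpa [h.depth] using hd, fun _ _ _ => Iff.rfl⟩

theorem top (hn : 0 < n) (hd : 0 ≤ d) : ExDef K n d (fun _ _ _ => True) :=
  (of_qfree (.eq ⟨0, hn⟩ ⟨0, hn⟩) (by simp [CForm.qfree]) hd).congr fun _ _ _ => by simp [CForm.Realize]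

theorem eq (i j : Fin n) (hd : 0 ≤ d) : ExDef K n d (fun _ _ f => f i = f j) :=
  of_qfree (.eq i j) trivial hd

theorem ne (i j : Fin n) (hd : 0 ≤ d) : ExDef K n d (fun _ _ f => f i ≠ f j) :=
  of_qfree (.neg (.eq i j)) trivial hd

theorem adj (i j : Fin n) (hd : 0 ≤ d) : ExDef K n d (fun _ C f => C.graph.Adj (f i) (f j)) :=
  of_qfree (.adj i j) trivial hd

theorem color_iff (c : Fin K) (i : Fin n) (p : Prop) (hd : 0 ≤ d) :
    ExDef K n d (fun _ C f => C.color c (f i) ↔ p) := by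
  by_cases hp : p
  · exact (of_qfree (.col c i) trivial hd).congr fun _ _ _ => by simp [CForm.Realize, hp]
  · exact (of_qfree (.neg (.col c i)) trivial hd).congr fun _ _ _ => by simp [CForm.Realize, hp]

theorem imp (hn : 0 < n) (hd : 0 ≤ d) (p : Prop) (h : p → ExDef K n d P) :
    ExDef K n d (fun V C f => p → P V C f) := by
  by_cases hp : p
  · exact (h hp).congr fun _ _ _ => by simp [hp]
  · exact (top hn hd).congr fun _ _ _ => by simp [hp]

theorem all (hn : 0 < n) (hd : 0 ≤ d) {ι : Type*} [Finite ι]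
    {R : ι → ∀ V : Type, CGraph K V → (Fin n → V) → Prop} (h : ∀ i, ExDef K n d (R i)) :
    ExDef K n d (fun V C f => ∀ i, R i V C f) := by
  classical
  cases nonempty_fintype ι
  have key : ∀ s : Finset ι, ExDef K n d (fun V C f => ∀ i ∈ s, R i V C f) := by
    intro s
    induction s using Finset.induction_on with
    | empty => exact (top hn hd).congr fun _ _ _ => by simp
    | insert a s _ ih => exact ((h a).and ih).congr fun _ _ _ => by simp
  exact (key Finset.univ).congr fun _ _ _ => by simp

end ExDef

section Branch

variable {W : Type*} {G : SimpleGraph W} {c v v' w u : W}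

/-- The vertices reachable from `v` by walks avoiding `c`. -/
def branch (G : SimpleGraph W) (c v : W) : Set W := {w | ∃ p : G.Walk v w, c ∉ p.support}

theorem ne_of_mem_branch (h : w ∈ branch G c v) : w ≠ c := by
  rintro rfl
  obtain ⟨p, hp⟩ := h
  exact hp p.end_mem_support

theorem self_mem_branch (h : G.Adj c v) : v ∈ branch G c v :=
  ⟨.nil, by simpa using h.ne⟩

theorem mem_branch_of_adj (hw : w ∈ branch G c v) (h : G.Adj w u) (hu : u ≠ c) :
    u ∈ branch G c v := by
  obtain ⟨p, hp⟩ := hw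
  refine ⟨p.concat h, ?_⟩
  simp [Walk.support_concat, hp, hu.symm]

theorem branch_unique (hG : G.IsAcyclic) (hv : G.Adj c v) (hv' : G.Adj c v')
    (h : w ∈ branch G c v) (h' : w ∈ branch G c v') : v = v' := by
  classical
  by_contra hne
  obtain ⟨p, hp⟩ := h
  obtain ⟨p', hp'⟩ := h'
  have hq : c ∉ (p.append p'.reverse).support := by
    simp [Walk.mem_support_append_iff, hp, hp']
  let r : G.Walk v v' := .cons hv.symm (.cons hv' .nil)
  have hr : r.IsPath := by
    simp [r, Walk.isPath_def, hv.ne.symm, hv'.ne, hne]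
  have := (hG.subsingleton_path v v').elim ⟨r, hr⟩ (p.append p'.reverse).toPath
  have hc : c ∈ ((p.append p'.reverse).toPath : G.Walk v v').support := by
    rw [← this]
    simp [r]
  exact hq (Walk.support_bypass_subset_support _ hc)

theorem exists_mem_branch (hG : G.Connected) (h : w ≠ c) :
    ∃ v, G.Adj c v ∧ w ∈ branch G c v ∧ G.dist v w < G.dist c w := by
  obtain ⟨p, hp, hlen⟩ := hG.exists_path_of_dist c w
  cases p with
  | nil => exact absurd rfl h
  | @cons _ v _ hadj q =>
    rw [Walk.cons_isPath_iff] at hp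
    refine ⟨v, hadj, ⟨q, hp.2⟩, ?_⟩
    have := dist_le q
    rw [Walk.length_cons] at hlen
    omega

theorem dist_lt_of_mem_branch (hG : G.Connected) (hG' : G.IsAcyclic) (hv : G.Adj c v)
    (h : w ∈ branch G c v) : G.dist v w < G.dist c w := by
  obtain ⟨v', h₁, h₂, h₃⟩ := exists_mem_branch hG (ne_of_mem_branch h)
  rwa [branch_unique hG' hv h₁ h h₂]

open scoped Classical in
/-- Every finite set of vertices of a finite tree has a centroid. -/
theorem exists_centroid [Finite W] (hG : G.Connected) (hG' : G.IsAcyclic) (S : Finset W) :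
    ∃ c, ∀ v, G.Adj c v → 2 * (S.filter (· ∈ branch G c v)).card ≤ S.card := by
  have := hG.nonempty
  obtain ⟨c, hc⟩ := Finite.exists_min fun c => ∑ w ∈ S, G.dist c w
  refine ⟨c, fun v hv => ?_⟩
  by_contra! hlt
  have hle := hc v
  have hcard := Finset.card_filter_add_card_filter_not (s := S) (· ∈ branch G c v)
  have key : ∑ w ∈ S, G.dist v w + (S.filter (· ∈ branch G c v)).card ≤
      ∑ w ∈ S, G.dist c w + (S.filter (· ∉ branch G c v)).card := by
    simp only [Finset.card_filter, ← Finset.sum_add_distrib]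
    refine Finset.sum_le_sum fun w _ => ?_
    by_cases hw : w ∈ branch G c v
    · have := dist_lt_of_mem_branch hG hG' hv hw
      simp [hw]
      omega
    · have h₁ := hG.dist_triangle (u := v) (v := c) (w := w)
      have h₂ : G.dist v c = 1 := dist_eq_one_iff_adj.mpr hv.symm
      simp [hw]
      omega
  omega

open scoped Classical in
theorem card_mul_le_of_le_card_branch (hG' : G.IsAcyclic) (S D : Finset W)
    (hD : ∀ u ∈ D, G.Adj c u) {t : ℕ}
    (ht : ∀ u ∈ D, t ≤ (S.filter (· ∈ branch G c u)).card) : D.card * t ≤ S.card := by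
  calc D.card * t ≤ ∑ u ∈ D, (S.filter (· ∈ branch G c u)).card := by
        simpa using Finset.card_nsmul_le_sum D _ t ht
    _ = (D.biUnion fun u => S.filter (· ∈ branch G c u)).card := by
        refine (Finset.card_biUnion fun u hu u' hu' hne => ?_).symm
        refine Finset.disjoint_left.mpr fun w hw hw' => ?_
        exact hne (branch_unique hG' (hD u hu) (hD u' hu') (Finset.mem_filter.mp hw).2
          (Finset.mem_filter.mp hw').2)
    _ ≤ S.card := Finset.card_le_card fun w hw => by
        obtain ⟨u, -, hu⟩ := Finset.mem_biUnion.mp hw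
        exact (Finset.mem_filter.mp hu).1

end Branch

section Ext

variable {K n : ℕ} {W : Type} {T : CGraph K W} {b : Prop} {S A B : Finset W}
  {q : Fin n → Option W}

/-- On the vertices of `S`, the map `h` preserves adjacency, is injective on neighborhoods and,
if `b` holds, respects colors. -/
def LocEmb (T : CGraph K W) (b : Prop) (S : Finset W) {V : Type} (C : CGraph K V)
    (h : W → V) : Prop :=
  ∀ w ∈ S, (b → ∀ k, C.color k (h w) ↔ T.color k w) ∧
    (∀ u, T.graph.Adj w u → C.graph.Adj (h w) (h u)) ∧
    ∀ u u', T.graph.Adj w u → T.graph.Adj w u' → u ≠ u' → h u ≠ h u'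

/-- There is a locally injective map on `S` which takes the prescribed values at the vertices
named by `q` and avoids on `S` the values with index labelled `none`. -/
def Ext (T : CGraph K W) (b : Prop) (S : Finset W) (q : Fin n → Option W) (V : Type)
    (C : CGraph K V) (f : Fin n → V) : Prop :=
  ∃ h : W → V, (∀ j w, q j = some w → h w = f j) ∧ (∀ j, q j = none → ∀ w ∈ S, h w ≠ f j) ∧
    LocEmb T b S C h

/-- All outer boundary vertices of `S` are named by `q`. -/
def Covered (T : CGraph K W) (S : Finset W) (q : Fin n → Option W) : Prop :=
  ∀ w ∈ S, ∀ u ∉ S, T.graph.Adj w u → ∃ j, q j = some u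

theorem ext_iff_exists_snoc (c : W) (V : Type) (C : CGraph K V) (f : Fin n → V) :
    Ext T b S q V C f ↔
      ∃ x : V, Ext T b S (Fin.snoc q (some c) : Fin (n + 1) → Option W) V C (Fin.snoc f x) := by
  constructor
  · rintro ⟨h, h₁, h₂, h₃⟩
    refine ⟨h c, h, fun j => ?_, fun j => ?_, h₃⟩
    · refine Fin.lastCases ?_ (fun j => ?_) j
      · simp
      · simpa using h₁ j
    · refine Fin.lastCases ?_ (fun j => ?_) j
      · simp
      · simpa using h₂ j
  · rintro ⟨x, h, h₁, h₂, h₃⟩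
    refine ⟨h, fun j => ?_, fun j => ?_, h₃⟩
    · simpa using h₁ j.castSucc
    · simpa using h₂ j.castSucc

theorem ext_union [DecidableEq W] (hAB : Disjoint A B) (hA : Covered T A q)
    (hB : Covered T B q) (V : Type) (C : CGraph K V) (f : Fin n → V) :
    Ext T b (A ∪ B) q V C f ↔ Ext T b A q V C f ∧ Ext T b B q V C f := by
  constructor
  · rintro ⟨h, h₁, h₂, h₃⟩
    exact ⟨⟨h, h₁, fun j hj w hw => h₂ j hj w (Finset.mem_union_left _ hw),
      fun w hw => h₃ w (Finset.mem_union_left _ hw)⟩,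
      ⟨h, h₁, fun j hj w hw => h₂ j hj w (Finset.mem_union_right _ hw),
      fun w hw => h₃ w (Finset.mem_union_right _ hw)⟩⟩
  · rintro ⟨⟨g, g₁, g₂, g₃⟩, ⟨h, h₁, h₂, h₃⟩⟩
    let k : W → V := fun w => if w ∈ A then g w else h w
    have hkg : ∀ w u, w ∈ A → (u = w ∨ T.graph.Adj w u) → k u = g u := by
      intro w u hw hu
      by_cases huA : u ∈ A
      · simp [k, huA]
      · rcases hu with rfl | hu
        · exact absurd hw huA
        · obtain ⟨j, hj⟩ := hA w hw u huA hu
          simp [k, huA, g₁ j u hj, h₁ j u hj]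
    have hkh : ∀ w u, w ∈ B → (u = w ∨ T.graph.Adj w u) → k u = h u := by
      intro w u hw hu
      by_cases huA : u ∈ A
      · have huB : u ∉ B := Finset.disjoint_left.mp hAB huA
        rcases hu with rfl | hu
        · exact absurd hw huB
        · obtain ⟨j, hj⟩ := hB w hw u huB hu
          simp [k, huA, g₁ j u hj, h₁ j u hj]
      · simp [k, huA]
    refine ⟨k, fun j w hj => ?_, fun j hj w hw => ?_, fun w hw => ?_⟩
    · by_cases hw : w ∈ A
      · simp [k, hw, g₁ j w hj]
      · simp [k, hw, h₁ j w hj]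
    · rcases Finset.mem_union.mp hw with hw | hw
      · rw [hkg w w hw (.inl rfl)]
        exact g₂ j hj w hw
      · rw [hkh w w hw (.inl rfl)]
        exact h₂ j hj w hw
    · rcases Finset.mem_union.mp hw with hw | hw
      · obtain ⟨r₁, r₂, r₃⟩ := g₃ w hw
        refine ⟨?_, fun u hu => ?_, fun u u' hu hu' => ?_⟩
        · rwa [hkg w w hw (.inl rfl)]
        · rw [hkg w w hw (.inl rfl), hkg w u hw (.inr hu)]
          exact r₂ u hu
        · rw [hkg w u hw (.inr hu), hkg w u' hw (.inr hu')]
          exact r₃ u u' hu hu'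
      · obtain ⟨r₁, r₂, r₃⟩ := h₃ w hw
        refine ⟨?_, fun u hu => ?_, fun u u' hu hu' => ?_⟩
        · rwa [hkh w w hw (.inl rfl)]
        · rw [hkh w w hw (.inl rfl), hkh w u hw (.inr hu)]
          exact r₂ u hu
        · rw [hkh w u hw (.inr hu), hkh w u' hw (.inr hu')]
          exact r₃ u u' hu hu'

/-- If `S` and its boundary are named by `q`, then `Ext` is quantifier-free definable. -/
theorem exDef_ext_of_named [Finite W] (hn : 0 < n) {d : ℝ} (hd : 0 ≤ d)
    (hS : ∀ w ∈ S, ∃ j, q j = some w) (hcov : Covered T S q) :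
    ExDef K n d (Ext T b S q) := by
  classical
  have hnb : ∀ w ∈ S, ∀ u, T.graph.Adj w u → ∃ j, q j = some u := by
    intro w hw u hu
    by_cases huS : u ∈ S
    · exact hS u huS
    · exact hcov w hw u huS hu
  have E₁ : ExDef K n d fun _ _ f => ∀ (w : W) (i j : Fin n),
      q i = some w ∧ q j = some w → f i = f j :=
    .all hn hd fun w => .all hn hd fun i => .all hn hd fun j => .imp hn hd _ fun _ => .eq i j hd
  have E₂ : ExDef K n d fun _ _ f => ∀ (w : W) (i j : Fin n),
      q i = some w ∧ q j = none ∧ w ∈ S → f i ≠ f j :=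
    .all hn hd fun w => .all hn hd fun i => .all hn hd fun j => .imp hn hd _ fun _ => .ne i j hd
  have E₃ : ExDef K n d fun _ C f => ∀ (w : W) (i : Fin n) (k : Fin K),
      q i = some w ∧ w ∈ S ∧ b → (C.color k (f i) ↔ T.color k w) :=
    .all hn hd fun w => .all hn hd fun i => .all hn hd fun k => .imp hn hd _ fun _ =>
      .color_iff k i _ hd
  have E₄ : ExDef K n d fun _ C f => ∀ (w u : W) (i j : Fin n),
      q i = some w ∧ q j = some u ∧ w ∈ S ∧ T.graph.Adj w u → C.graph.Adj (f i) (f j) :=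
    .all hn hd fun w => .all hn hd fun u => .all hn hd fun i => .all hn hd fun j =>
      .imp hn hd _ fun _ => .adj i j hd
  have E₅ : ExDef K n d fun _ C f => ∀ (w u u' : W) (i j : Fin n),
      w ∈ S ∧ q i = some u ∧ q j = some u' ∧ T.graph.Adj w u ∧ T.graph.Adj w u' ∧ u ≠ u' →
        f i ≠ f j :=
    .all hn hd fun w => .all hn hd fun u => .all hn hd fun u' => .all hn hd fun i =>
      .all hn hd fun j => .imp hn hd _ fun _ => .ne i j hd
  refine ((E₁.and E₂).and (E₃.and (E₄.and E₅))).congr fun V C f => ?_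
  constructor
  · rintro ⟨⟨e₁, e₂⟩, e₃, e₄, e₅⟩
    have hex : ∀ w : W, ∃ x : V, ∀ j, q j = some w → x = f j := by
      intro w
      by_cases hw : ∃ j, q j = some w
      · obtain ⟨j, hj⟩ := hw
        exact ⟨f j, fun i hi => e₁ w j i ⟨hj, hi⟩⟩
      · exact ⟨f ⟨0, hn⟩, fun j hj => absurd ⟨j, hj⟩ hw⟩
    choose h hh using hex
    refine ⟨h, fun j w hj => hh w j hj, fun j hj w hw => ?_, fun w hw => ?_⟩
    · obtain ⟨i, hi⟩ := hS w hw
      rw [hh w i hi]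
      exact e₂ w i j ⟨hi, hj, hw⟩
    · obtain ⟨i, hi⟩ := hS w hw
      refine ⟨fun hb k => ?_, fun u hu => ?_, fun u u' hu hu' hne => ?_⟩
      · rw [hh w i hi]
        exact e₃ w i k ⟨hi, hw, hb⟩
      · obtain ⟨j, hj⟩ := hnb w hw u hu
        rw [hh w i hi, hh u j hj]
        exact e₄ w u i j ⟨hi, hj, hw, hu⟩
      · obtain ⟨j, hj⟩ := hnb w hw u hu
        obtain ⟨j', hj'⟩ := hnb w hw u' hu'
        rw [hh u j hj, hh u' j' hj']
        exact e₅ w u u' j j' ⟨hw, hj, hj', hu, hu', hne⟩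
  · rintro ⟨h, h₁, h₂, h₃⟩
    refine ⟨⟨?_, ?_⟩, ?_, ?_, ?_⟩
    · rintro w i j ⟨hi, hj⟩
      rw [← h₁ i w hi, ← h₁ j w hj]
    · rintro w i j ⟨hi, hj, hw⟩
      rw [← h₁ i w hi]
      exact h₂ j hj w hw
    · rintro w i k ⟨hi, hw, hb⟩
      rw [← h₁ i w hi]
      exact (h₃ w hw).1 hb k
    · rintro w u i j ⟨hi, hj, hw, hu⟩
      rw [← h₁ i w hi, ← h₁ j u hj]
      exact (h₃ w hw).2.1 u hu
    · rintro w u u' i j ⟨hw, hi, hj, hu, hu', hne⟩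
      rw [← h₁ i u hi, ← h₁ j u' hj]
      exact (h₃ w hw).2.2 u u' hu hu' hne

end Ext

section Depth

variable {K l : ℕ} {W : Type} [Finite W] {T : CGraph K W} {b : Prop} {α : ℝ}

open scoped Classical in
/-- Processing the branches at a named vertex `c` in order of decreasing size. -/
theorem exDef_ext_branches (hac : T.graph.IsAcyclic) (hdeg : ∀ v, deg T.graph v ≤ l)
    (hα : ∀ i : ℕ, 1 ≤ i → i ≤ l → (1 + i : ℝ) ≤ α * Real.log (max 2 i : ℕ)) (hα₀ : 0 ≤ α)
    {S : Finset W} {c : W}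
    (hc : ∀ v, T.graph.Adj c v → 2 * (S.filter (· ∈ branch T.graph c v)).card ≤ S.card)
    (hS : ∀ v, T.graph.Adj c v → ∀ (n : ℕ) (q : Fin n → Option W), 0 < n →
      Covered T (S.filter (· ∈ branch T.graph c v)) q →
      ExDef K n (1 + α * Real.log (S.filter (· ∈ branch T.graph c v)).card)
        (Ext T b (S.filter (· ∈ branch T.graph c v)) q))
    {M : Finset W} (hM : ∀ v, v ∈ M ↔
      T.graph.Adj c v ∧ (S.filter (· ∈ branch T.graph c v)).Nonempty)
    (k : ℕ) (N : Finset W) (hN : N.card = k) (hNM : N ⊆ M) {n : ℕ} (q : Fin n → Option W)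
    (hq : Covered T S q) (hqc : ∃ j, q j = some c) (hqM : ∀ v ∈ M \ N, ∃ j, q j = some v)
    (hmax : ∀ u ∈ M \ N, ∀ v ∈ N, (S.filter (· ∈ branch T.graph c v)).card ≤
      (S.filter (· ∈ branch T.graph c u)).card)
    (hbud : ((M \ N).card : ℝ) ≤ α * Real.log S.card) :
    ExDef K n (α * Real.log S.card - (M \ N).card)
      (Ext T b (S.filter fun w => w = c ∨ ∃ v ∈ N, w ∈ branch T.graph c v) q) := by
  have hn : 0 < n := hqc.elim fun j _ => j.pos
  have hcovN : ∀ {n : ℕ} (q : Fin n → Option W) (N : Finset W), Covered T S q →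
      (∀ v ∈ M \ N, ∃ j, q j = some v) →
      Covered T (S.filter fun w => w = c ∨ ∃ v ∈ N, w ∈ branch T.graph c v) q := by
    intro n q N hq hqM w hw u hu hwu
    rw [Finset.mem_filter] at hw hu
    by_cases huS : u ∈ S
    · have hu' : ¬ (u = c ∨ ∃ v ∈ N, u ∈ branch T.graph c v) := fun h => hu ⟨huS, h⟩
      push Not at hu'
      rcases hw.2 with rfl | ⟨v, hv, hwv⟩
      · have hub := self_mem_branch hwu
        refine hqM u (Finset.mem_sdiff.mpr ⟨(hM u).mpr ⟨hwu, u, ?_⟩, fun h => hu'.2 u h hub⟩)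
        exact Finset.mem_filter.mpr ⟨huS, hub⟩
      · exact absurd (mem_branch_of_adj hwv hwu hu'.1) (hu'.2 v hv)
    · exact hq w hw.1 u huS hwu
  induction k generalizing N n q with
  | zero =>
    obtain rfl := Finset.card_eq_zero.mp hN
    refine exDef_ext_of_named hn (by linarith) (fun w hw => ?_) (hcovN q ∅ hq hqM)
    obtain rfl : w = c := by simpa using (Finset.mem_filter.mp hw).2
    exact hqc
  | succ k ih =>
    obtain ⟨v, hvN, hv⟩ := N.exists_max_image
      (fun v => (S.filter (· ∈ branch T.graph c v)).card)
      (Finset.card_pos.mp (by omega))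
    obtain ⟨hcv, hSv⟩ := (hM v).mp (hNM hvN)
    have hsd : M \ N.erase v = insert v (M \ N) := by
      ext u
      by_cases huv : u = v
      · subst huv
        simp [hNM hvN]
      · simp [huv]
    have hvn : v ∉ M \ N := by simp [hvN]
    have hcard : (M \ N.erase v).card = (M \ N).card + 1 := by
      rw [hsd, Finset.card_insert_of_notMem hvn]
    have hadj : ∀ u ∈ M \ N.erase v, T.graph.Adj c u := fun u hu =>
      ((hM u).mp (Finset.mem_sdiff.mp hu).1).1
    have hbig : ∀ u ∈ M \ N.erase v, (S.filter (· ∈ branch T.graph c v)).card ≤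
        (S.filter (· ∈ branch T.graph c u)).card := by
      intro u hu
      rw [hsd, Finset.mem_insert] at hu
      rcases hu with rfl | hu
      · exact le_rfl
      · exact hmax u hu v hvN
    set i := (M \ N.erase v).card with hi
    have hil : i ≤ l := by
      refine le_trans ?_ (hdeg c)
      have hsub : ((M \ N.erase v : Finset W) : Set W) ⊆ {w | T.graph.Adj c w} :=
        fun u hu => hadj u hu
      have := Set.ncard_le_ncard hsub (Set.toFinite _)
      rwa [Set.ncard_coe_finset] at this
    have h₁ := card_mul_le_of_le_card_branch hac S _ hadj hbig
    have h₂ := hc v hcv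
    set t := (S.filter (· ∈ branch T.graph c v)).card with ht
    have ht₀ : 0 < t := Finset.card_pos.mpr hSv
    have h₃ : max 2 i * t ≤ S.card := by
      rcases max_choice 2 i with h | h <;> rw [h] <;> assumption
    have h₄ : Real.log (max 2 i : ℕ) + Real.log t ≤ Real.log S.card := by
      rw [← Real.log_mul (by positivity) (by positivity)]
      exact Real.log_le_log (by positivity) (by exact_mod_cast h₃)
    have h₅ : (1 + i : ℝ) + α * Real.log t ≤ α * Real.log S.card := by
      have := hα i (by omega) hil
      nlinarith [mul_le_mul_of_nonneg_left h₄ hα₀]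
    have h₆ : 0 ≤ α * Real.log t := mul_nonneg hα₀ (Real.log_natCast_nonneg t)
    have hcardR : (i : ℝ) = (M \ N).card + 1 := by exact_mod_cast hcard
    have hq' : Covered T S (Fin.snoc q (some v) : Fin (n + 1) → Option W) := by
      intro w hw u hu hwu
      obtain ⟨j, hj⟩ := hq w hw u hu hwu
      exact ⟨j.castSucc, by simpa using hj⟩
    have hqc' : ∃ j, (Fin.snoc q (some v) : Fin (n + 1) → Option W) j = some c := by
      obtain ⟨j, hj⟩ := hqc
      exact ⟨j.castSucc, by simpa using hj⟩
    have hqM' : ∀ u ∈ M \ N.erase v,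
        ∃ j, (Fin.snoc q (some v) : Fin (n + 1) → Option W) j = some u := by
      intro u hu
      rw [hsd, Finset.mem_insert] at hu
      rcases hu with rfl | hu
      · exact ⟨Fin.last n, by simp⟩
      · obtain ⟨j, hj⟩ := hqM u hu
        exact ⟨j.castSucc, by simpa using hj⟩
    have hcovv : Covered T (S.filter (· ∈ branch T.graph c v))
        (Fin.snoc q (some v) : Fin (n + 1) → Option W) := by
      intro w hw u hu hwu
      rw [Finset.mem_filter] at hw hu
      by_cases huS : u ∈ S
      · by_cases huc : u = c
        · exact huc ▸ hqc'
        · exact absurd ⟨huS, mem_branch_of_adj hw.2 hwu huc⟩ hu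
      · exact hq' w hw.1 u huS hwu
    have hrec := ih (N.erase v) (by rw [Finset.card_erase_of_mem hvN, hN]; rfl)
      ((Finset.erase_subset _ _).trans hNM) _ hq' hqc' hqM'
      (fun u hu w hw => by
        refine (hv w (Finset.mem_of_mem_erase hw)).trans (hbig u hu))
      (by rw [← hi]; linarith) n.succ_pos
    have hone := hS v hcv (n + 1) _ n.succ_pos hcovv
    have hunion : (S.filter fun w => w = c ∨ ∃ v ∈ N, w ∈ branch T.graph c v) =
        S.filter (· ∈ branch T.graph c v) ∪
          S.filter fun w => w = c ∨ ∃ u ∈ N.erase v, w ∈ branch T.graph c u := by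
      ext w
      simp only [Finset.mem_filter, Finset.mem_union, Finset.mem_erase]
      constructor
      · rintro ⟨hw, h | ⟨u, hu, huw⟩⟩
        · exact .inr ⟨hw, .inl h⟩
        · by_cases huv : u = v
          · exact .inl ⟨hw, huv ▸ huw⟩
          · exact .inr ⟨hw, .inr ⟨u, ⟨huv, hu⟩, huw⟩⟩
      · rintro (⟨hw, h⟩ | ⟨hw, h | ⟨u, hu, huw⟩⟩)
        · exact ⟨hw, .inr ⟨v, hvN, h⟩⟩
        · exact ⟨hw, .inl h⟩
        · exact ⟨hw, .inr ⟨u, hu.2, huw⟩⟩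
    have hdisj : Disjoint (S.filter (· ∈ branch T.graph c v))
        (S.filter fun w => w = c ∨ ∃ u ∈ N.erase v, w ∈ branch T.graph c u) := by
      rw [Finset.disjoint_left]
      intro w hw hw'
      rw [Finset.mem_filter] at hw hw'
      rcases hw'.2 with h | ⟨u, hu, huw⟩
      · exact ne_of_mem_branch hw.2 h
      · rw [Finset.mem_erase] at hu
        exact hu.1 (branch_unique hac ((hM u).mp (hNM hu.2)).1 hcv huw hw.2)
    have hboth := (hone.mono (e := α * Real.log S.card - i) (by linarith)).and
      (hrec.mono (e := α * Real.log S.card - i) (by rw [← hi]))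
    refine (hboth.exists_snoc.mono (by linarith)).congr fun V C f => ?_
    rw [ext_iff_exists_snoc v, hunion]
    exact exists_congr fun x =>
      (ext_union hdisj hcovv (hcovN _ _ hq' hqM') V C (Fin.snoc f x)).symm

theorem exDef_ext (hcon : T.graph.Connected) (hac : T.graph.IsAcyclic)
    (hdeg : ∀ v, deg T.graph v ≤ l)
    (hα : ∀ i : ℕ, 1 ≤ i → i ≤ l → (1 + i : ℝ) ≤ α * Real.log (max 2 i : ℕ)) (hα₀ : 0 ≤ α)
    (S : Finset W) {n : ℕ} (q : Fin n → Option W) (hn : 0 < n ∨ S.Nonempty)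
    (hq : Covered T S q) :
    ExDef K n (1 + α * Real.log S.card) (Ext T b S q) := by
  classical
  induction hs : S.card using Nat.strong_induction_on generalizing S n q with
  | _ s ih =>
  subst hs
  rcases S.eq_empty_or_nonempty with rfl | hne
  · exact exDef_ext_of_named (by simpa using hn) (by simp) (by simp) hq
  obtain ⟨c, hc⟩ := exists_centroid hcon hac S
  cases nonempty_fintype W
  let M : Finset W := Finset.univ.filter fun v =>
    T.graph.Adj c v ∧ (S.filter (· ∈ branch T.graph c v)).Nonempty
  have hq' : Covered T S (Fin.snoc q (some c) : Fin (n + 1) → Option W) := by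
    intro w hw u hu hwu
    obtain ⟨j, hj⟩ := hq w hw u hu hwu
    exact ⟨j.castSucc, by simpa using hj⟩
  have key := exDef_ext_branches (b := b) hac hdeg hα hα₀ hc
    (fun v hv n q hn hcov => ih _ (by
      have := hc v hv
      have := hne.card_pos
      omega) _ q (.inl hn) hcov rfl)
    (M := M) (fun v => by simp [M]) M.card M rfl subset_rfl _ hq' ⟨Fin.last n, by simp⟩
    (by simp) (by simp) (by
      simpa using mul_nonneg hα₀ (Real.log_natCast_nonneg S.card))
  have hS : (S.filter fun w => w = c ∨ ∃ v ∈ M, w ∈ branch T.graph c v) = S := by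
    rw [Finset.filter_eq_self]
    intro w hw
    by_cases hwc : w = c
    · exact .inl hwc
    · obtain ⟨v, h₁, h₂, -⟩ := exists_mem_branch hcon hwc
      exact .inr ⟨v, Finset.mem_filter.mpr ⟨Finset.mem_univ _, h₁, w,
        Finset.mem_filter.mpr ⟨hw, h₂⟩⟩, h₂⟩
  rw [hS] at key
  refine (key.exists_snoc.mono (le_of_eq ?_)).congr fun V C f =>
    (ext_iff_exists_snoc c V C f).symm
  simp
  ring

end Depth

section Rigidity

theorem isPath_map_of_locallyInjective {V W : Type*} {G : SimpleGraph W} {H : SimpleGraph V}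
    (hH : H.IsAcyclic) (φ : G →g H)
    (hφ : ∀ w u u', G.Adj w u → G.Adj w u' → u ≠ u' → φ u ≠ φ u') {u v : W} {p : G.Walk u v}
    (hp : p.IsPath) : (p.map φ).IsPath := by
  rw [hH.isPath_iff_isChain]
  induction p with
  | nil => simp
  | @cons x y z hxy q ih =>
    have hq := (Walk.cons_isPath_iff _ _).mp hp
    have ihq := ih hq.1
    cases q with
    | nil => simp
    | @cons _ w _ hyw r =>
      have hxw : x ≠ w := by
        rintro rfl
        exact hq.2 (by simp)
      have := hφ y x w hxy.symm hyw hxw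
      have hne := (φ.map_adj hxy).ne
      simp only [Walk.map_cons, Walk.edges_cons, List.isChain_cons_cons] at ihq ⊢
      refine ⟨?_, ihq⟩
      rw [Ne, Sym2.eq_iff]
      rintro (⟨h₁, -⟩ | ⟨h₁, -⟩)
      · exact hne h₁
      · exact this h₁

variable {K : ℕ} {V W : Type} [Fintype W] {T : CGraph K W} {C : CGraph K V} {b : Prop}
  {h : W → V}

/-- The graph homomorphism underlying a locally injective map. -/
def LocEmb.hom (hh : LocEmb T b Finset.univ C h) : T.graph →g C.graph :=
  ⟨h, fun {w u} hwu => (hh w (Finset.mem_univ w)).2.1 u hwu⟩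

theorem LocEmb.isPath_map (hh : LocEmb T b Finset.univ C h) (hC : C.graph.IsAcyclic) {u v : W}
    {p : T.graph.Walk u v} (hp : p.IsPath) : (p.map hh.hom).IsPath :=
  isPath_map_of_locallyInjective hC hh.hom (fun w => (hh w (Finset.mem_univ w)).2.2) hp

theorem LocEmb.injective (hh : LocEmb T b Finset.univ C h) (hT : T.graph.Connected)
    (hC : C.graph.IsAcyclic) : Function.Injective h := by
  intro u v huv
  obtain ⟨p, hp, -⟩ := hT.exists_path_of_dist u v
  have hp' := hh.isPath_map hC hp
  by_contra hne
  have hlen : p.length ≠ 0 := fun h0 => hne (Walk.eq_of_length_eq_zero h0)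
  have h0 := hp'.getVert_injOn (x₁ := 0) (x₂ := p.length) (by simp) (by simp) (by
    simpa [LocEmb.hom, Walk.getVert_map] using huv)
  exact hlen h0.symm

theorem LocEmb.adj_iff (hh : LocEmb T b Finset.univ C h) (hT : T.graph.Connected)
    (hC : C.graph.IsAcyclic) (u v : W) : T.graph.Adj u v ↔ C.graph.Adj (h u) (h v) := by
  refine ⟨fun huv => (hh u (Finset.mem_univ u)).2.1 v huv, fun huv => ?_⟩
  obtain ⟨p, hp, -⟩ := hT.exists_path_of_dist u v
  have huv' : C.graph.Adj (hh.hom u) (hh.hom v) := huv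
  have heq := (hC.subsingleton_path _ _).elim ⟨_, hh.isPath_map hC hp⟩ (Path.singleton huv')
  have hlen : p.length = 1 := by
    have := congrArg (fun q : C.graph.Path (hh.hom u) (hh.hom v) => q.1.length) heq
    simpa [Path.singleton] using this
  exact Walk.adj_of_length_eq_one hlen

end Rigidity

section PathGraph

theorem cycle_adj_succ {n : ℕ} (u : Fin (n + 3)) : (cycleGraph (n + 3)).Adj u (u + 1) := by
  rw [cycleGraph_adj']
  simp

theorem pathGraph_isAcyclic (n : ℕ) : (pathGraph n).IsAcyclic := by
  rw [isAcyclic_iff_free_cycleGraph]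
  rintro k hk ⟨φ⟩
  obtain ⟨k, rfl⟩ := Nat.exists_eq_add_of_le' hk
  obtain ⟨v, hv⟩ := Finite.exists_max fun v : Fin (k + 3) => φ v
  have h₁ : (pathGraph n).Adj (φ v) (φ (v + 1)) := φ.toHom.map_adj (cycle_adj_succ v)
  have h₂ : (pathGraph n).Adj (φ (v - 1)) (φ v) := by
    have := φ.toHom.map_adj (cycle_adj_succ (v - 1))
    rwa [sub_add_cancel] at this
  rw [pathGraph_adj] at h₁ h₂
  have h₃ : (φ (v + 1) : ℕ) ≤ φ v := hv (v + 1)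
  have h₄ : (φ (v - 1) : ℕ) ≤ φ v := hv (v - 1)
  have h₅ : φ (v + 1) = φ (v - 1) := Fin.ext (by omega)
  have h₆ : v + 1 = v - 1 := φ.injective h₅
  have h₇ : (1 : Fin (k + 3)) + 1 = 0 := by
    have := congrArg (fun x => x - v + 1) h₆
    simpa using this
  have := congrArg Fin.val h₇
  simp only [Fin.val_add, Fin.val_one, Fin.val_zero] at this
  rw [Nat.mod_eq_of_lt (by omega)] at this
  omega

theorem deg_pathGraph_le (n : ℕ) (v : Fin n) : deg (pathGraph n) v ≤ 2 := by
  have hinj : Set.InjOn (fun w : Fin n => (w : ℕ)) {w | (pathGraph n).Adj v w} :=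
    fun _ _ _ _ h => Fin.ext h
  have : (fun w : Fin n => (w : ℕ)) '' {w | (pathGraph n).Adj v w} ⊆
      (({(v : ℕ) - 1, (v : ℕ) + 1} : Finset ℕ) : Set ℕ) := by
    rintro _ ⟨w, hw, rfl⟩
    replace hw : (pathGraph n).Adj v w := hw
    rw [pathGraph_adj] at hw
    simp only [Finset.coe_insert, Finset.coe_singleton, Set.mem_insert_iff,
      Set.mem_singleton_iff]
    omega
  have h₁ := Set.ncard_le_ncard this (Finset.finite_toSet _)
  rw [hinj.ncard_image, Set.ncard_coe_finset] at h₁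
  exact h₁.trans Finset.card_le_two

/-- The path on `n` vertices, without colors. -/
def pathC (K n : ℕ) : CGraph K (Fin n) := ⟨pathGraph n, fun _ _ => False⟩

open scoped Fin.CommRing in
/-- Every graph with a cycle contains arbitrarily long locally injective walks. -/
theorem exists_locEmb_pathC {K n : ℕ} {V : Type} (C : CGraph K V) (hC : ¬ C.graph.IsAcyclic) :
    ∃ h, LocEmb (pathC K n) False Finset.univ C h := by
  rw [isAcyclic_iff_free_cycleGraph] at hC
  push Not at hC
  obtain ⟨k, hk, hfree⟩ := hC
  obtain ⟨k, rfl⟩ := Nat.exists_eq_add_of_le' hk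
  obtain ⟨φ⟩ := hfree
  have hadj : ∀ i : ℕ, C.graph.Adj (φ (i : Fin (k + 3))) (φ ((i + 1 : ℕ) : Fin (k + 3))) := by
    intro i
    rw [Nat.cast_succ]
    exact φ.toHom.map_adj (cycle_adj_succ _)
  have hne : ∀ i : ℕ, φ (i : Fin (k + 3)) ≠ φ ((i + 2 : ℕ) : Fin (k + 3)) := by
    intro i h
    have h₆ := φ.injective h
    rw [Nat.cast_add, left_eq_add] at h₆
    have := congrArg Fin.val h₆
    rw [Fin.val_natCast, Nat.mod_eq_of_lt (by omega)] at this
    simp at this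
  refine ⟨fun i => φ ((i : ℕ) : Fin (k + 3)), fun w _ => ⟨False.elim, fun u hu => ?_,
    fun u u' hu hu' huu' => ?_⟩⟩
  · replace hu : (pathGraph n).Adj w u := hu
    rw [pathGraph_adj] at hu
    rcases hu with hu | hu
    · simpa [hu] using hadj w
    · simpa [hu] using (hadj u).symm
  · replace hu : (pathGraph n).Adj w u := hu
    replace hu' : (pathGraph n).Adj w u' := hu'
    rw [pathGraph_adj] at hu hu'
    have hcases : (u' : ℕ) = u + 2 ∨ (u : ℕ) = u' + 2 := by
      have : (u : ℕ) ≠ u' := fun h => huu' (Fin.ext h)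
      omega
    rcases hcases with h | h
    · simpa [h] using hne u
    · simpa [h] using (hne u').symm

end PathGraph

section Define

variable {K m l : ℕ} {T : CGraph K (Fin m)} {α : ℝ}

theorem exists_defining_sentence (hT : IsColTree T) (hl : 2 ≤ l)
    (hdeg : ∀ v, deg T.graph v ≤ l)
    (hα : ∀ i : ℕ, 1 ≤ i → i ≤ l → (1 + i : ℝ) ≤ α * Real.log (max 2 i : ℕ)) (hα₀ : 0 ≤ α) :
    ∃ φ : CForm K 0, φ.negQF ∧ φ.altNum ≤ 0 ∧
      (φ.depth : ℝ) ≤ 2 + α * Real.log (m + 1 : ℕ) ∧ CDefines T φ := by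
  obtain ⟨hcon, hac⟩ := hT
  have hne : (Finset.univ : Finset (Fin m)).Nonempty :=
    Finset.univ_nonempty_iff.mpr hcon.nonempty
  have hm : 0 < m := by simpa using hne.card_pos
  have cov : ∀ {m n : ℕ} {T : CGraph K (Fin m)} {q : Fin n → Option (Fin m)},
    Covered T Finset.univ q := fun w _ u hu => absurd (Finset.mem_univ u) hu
  obtain ⟨φ₁, e₁, d₁, r₁⟩ := exDef_ext (b := True) hcon hac hdeg hα hα₀ Finset.univ
    (Fin.elim0 : Fin 0 → Option (Fin m)) (.inr hne) cov
  obtain ⟨φ₂, e₂, d₂, r₂⟩ := (exDef_ext (b := True) hcon hac hdeg hα hα₀ Finset.univ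
    (fun _ : Fin (0 + 1) => none) (.inr hne) cov).exists_snoc
  obtain ⟨φ₃, e₃, d₃, r₃⟩ := exDef_ext (T := pathC K (m + 1)) (b := False)
    (pathGraph_connected m) (pathGraph_isAcyclic _)
    (fun v => (deg_pathGraph_le _ v).trans hl) hα hα₀ Finset.univ
    (Fin.elim0 : Fin 0 → Option (Fin (m + 1))) (.inr Finset.univ_nonempty) cov
  obtain ⟨ψ₂, n₂, a₂, c₂, s₂⟩ := e₂.exists_dual
  obtain ⟨ψ₃, n₃, a₃, c₃, s₃⟩ := e₃.exists_dual
  rw [Finset.card_univ, Fintype.card_fin] at d₁ d₂ d₃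
  have hlog : α * Real.log m ≤ α * Real.log (m + 1 : ℕ) :=
    mul_le_mul_of_nonneg_left (Real.log_le_log (by exact_mod_cast hm)
      (by exact_mod_cast m.le_succ)) hα₀
  refine ⟨.conj φ₁ (.conj ψ₂ ψ₃), ⟨e₁.negQF, n₂, n₃⟩, ?_, ?_, ?_, ?_⟩
  · simp [CForm.altNum, CForm.altAux, e₁.altAux, a₂, a₃]
  · simp only [CForm.depth, c₂, c₃, Nat.cast_max]
    refine max_le ?_ (max_le ?_ ?_) <;> linarith
  · refine ⟨(r₁ _ _ _).mpr ⟨id, fun j => j.elim0, fun j => j.elim0, fun w _ =>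
      ⟨fun _ _ => Iff.rfl, fun _ hu => hu, fun _ _ _ _ h => h⟩⟩, (s₂ _ _ _).mpr fun h => ?_,
      (s₃ _ _ _).mpr fun h => ?_⟩
    · obtain ⟨z, h, -, hz, hh⟩ := (r₂ _ _ _).mp h
      obtain ⟨w, hw⟩ := Finite.injective_iff_surjective.mp (hh.injective hcon hac) z
      exact hz (Fin.last 0) rfl w (Finset.mem_univ w) (by simpa using hw)
    · obtain ⟨h, -, -, hh⟩ := (r₃ _ _ _).mp h
      have := Fintype.card_le_of_injective h (hh.injective (pathGraph_connected m) hac)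
      simp at this
  · rintro m' C ⟨h₁, h₂, h₃⟩
    have hC : C.graph.IsAcyclic := by
      by_contra hC
      obtain ⟨h, hh⟩ := exists_locEmb_pathC (n := m + 1) C hC
      exact (s₃ _ _ _).mp h₃ ((r₃ _ _ _).mpr ⟨h, fun j => j.elim0, fun j => j.elim0, hh⟩)
    obtain ⟨h, -, -, hh⟩ := (r₁ _ _ _).mp h₁
    have hsurj : Function.Surjective h := by
      intro z
      by_contra! hz
      refine (s₂ _ _ _).mp h₂ ((r₂ _ _ _).mpr ⟨z, h, fun j w hj => absurd hj (by simp), fun j _ w _ => ?_, hh⟩)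
      obtain rfl : j = Fin.last 0 := Subsingleton.elim (α := Fin 1) _ _
      simpa using hz w
    exact ⟨Equiv.ofBijective h ⟨hh.injective hcon hC, hsurj⟩, hh.adj_iff hcon hC,
      fun c v => ((hh v (Finset.mem_univ v)).1 trivial c).symm⟩

theorem Dtree_alt_zero_le (n : ℕ) (hl : 2 ≤ l)
    (hα : ∀ i : ℕ, 1 ≤ i → i ≤ l → (1 + i : ℝ) ≤ α * Real.log (max 2 i : ℕ)) (hα₀ : 0 ≤ α) :
    (Dtree_alt 0 n l : ℝ) ≤ 2 + α * Real.log (n + 1 : ℕ) := by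
  have hB : 0 ≤ 2 + α * Real.log (n + 1 : ℕ) := by
    have := mul_nonneg hα₀ (Real.log_natCast_nonneg (n + 1))
    linarith
  refine (Nat.le_floor_iff hB).mp ?_
  refine csSup_le' ?_
  rintro _ ⟨K, m, T, hT, hm, hdeg, rfl⟩
  obtain ⟨φ, h₁, h₂, h₃, h₄⟩ := exists_defining_sentence hT hl hdeg hα hα₀
  have hφ : Dcol_alt 0 T ≤ φ.depth := Nat.sInf_le ⟨φ, h₁, h₂, rfl, h₄⟩
  refine hφ.trans (Nat.le_floor (h₃.trans ?_))
  gcongr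

end Define

section Asymptotics

theorem eventually_rank_le {δ : ℝ} (hδ : 0 < δ) :
    ∀ᶠ l : ℕ in atTop, ∀ i : ℕ, 1 ≤ i → i ≤ l →
      (1 + i : ℝ) ≤ (1 + δ) * (l / Real.log l) * Real.log (max 2 i : ℕ) := by
  obtain ⟨k, hk⟩ := exists_nat_ge (max (1 / δ) 3)
  have hk₁ : 1 / δ ≤ k := (le_max_left _ _).trans hk
  have hk₃ : (3 : ℝ) ≤ k := (le_max_right _ _).trans hk
  have hsmall : ∀ᶠ l : ℕ in atTop, (1 + k) * Real.log l ≤ Real.log 2 * l := by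
    have h := (Real.isLittleO_log_id_atTop.comp_tendsto tendsto_natCast_atTop_atTop).def
      (c := Real.log 2 / (1 + k)) (div_pos (Real.log_pos (by norm_num)) (by positivity))
    filter_upwards [h] with l hl
    simp only [Function.comp_apply, id, Real.norm_natCast] at hl
    have := (le_abs_self _).trans hl
    rw [div_mul_eq_mul_div, le_div_iff₀ (by positivity)] at this
    linarith
  filter_upwards [hsmall, eventually_ge_atTop 2] with l hsm hl i hi hil
  have hlog : 0 < Real.log l := Real.log_pos (by exact_mod_cast hl)
  have hlR : (0 : ℝ) < l := by positivity
  rw [mul_div_assoc', div_mul_eq_mul_div, le_div_iff₀ hlog]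
  have hlogi : Real.log 2 ≤ Real.log (max 2 i : ℕ) :=
    Real.log_le_log (by norm_num) (by exact_mod_cast le_max_left 2 i)
  have hlog2 : 0 < Real.log 2 := Real.log_pos (by norm_num)
  rcases le_total i k with hik | hik
  · have hikR : (i : ℝ) ≤ k := by exact_mod_cast hik
    calc (1 + i) * Real.log l ≤ (1 + k) * Real.log l := by gcongr
      _ ≤ Real.log 2 * l := hsm
      _ ≤ l * Real.log (max 2 i : ℕ) := by
        rw [mul_comm]
        gcongr
      _ ≤ (1 + δ) * l * Real.log (max 2 i : ℕ) := by
        have : 0 ≤ δ * (l * Real.log (max 2 i : ℕ)) := by positivity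
        linarith
  · have hikR : (k : ℝ) ≤ i := by exact_mod_cast hik
    have hilR : (i : ℝ) ≤ l := by exact_mod_cast hil
    have hi₀ : (0 : ℝ) < i := by linarith
    have hmax : max 2 i = i := max_eq_right (by exact_mod_cast (by linarith : (2 : ℝ) ≤ i))
    rw [hmax] at hlogi ⊢
    have hanti := Real.log_div_self_antitoneOn
      (Set.mem_Ici.mpr (by linarith [Real.exp_one_lt_d9] : Real.exp 1 ≤ i))
      (Set.mem_Ici.mpr (by linarith [Real.exp_one_lt_d9] : Real.exp 1 ≤ l)) hilR
    simp only [div_le_div_iff₀ hlR hi₀] at hanti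
    have hδi : 1 ≤ δ * i := by
      have := (div_le_iff₀ hδ).mp (hk₁.trans hikR)
      linarith
    calc (1 + i) * Real.log l ≤ ((1 + δ) * i) * Real.log l := by
          gcongr
          linarith
      _ = (1 + δ) * (Real.log l * i) := by ring
      _ ≤ (1 + δ) * (Real.log i * l) := by gcongr
      _ = (1 + δ) * l * Real.log i := by ring

end Asymptotics

end FODef

theorem statement7 (l : ℕ → ℕ) (hpos : ∀ n, 1 ≤ l n)
    (hl : Tendsto l atTop atTop)
    (hratio : Tendsto (fun n : ℕ => Real.log n / Real.log (l n)) atTop atTop) :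
    ∀ ε : ℝ, 0 < ε → ∀ᶠ n in atTop,
      (Dtree_alt 0 n (l n) : ℝ) ≤ (1 + ε) * ((l n : ℝ) * Real.log n / Real.log (l n)) := by
  intro ε hε
  have hlog : Tendsto (fun n : ℕ => Real.log n) atTop atTop :=
    Real.tendsto_log_atTop.comp tendsto_natCast_atTop_atTop
  filter_upwards [hl.eventually (eventually_rank_le (half_pos hε)),
    hl.eventually (eventually_ge_atTop 2), eventually_ge_atTop 1,
    hlog.eventually (eventually_ge_atTop ((3 + ε / 2) / (ε / 2)))] with n hrank hl2 hn hlarge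
  have hl2R : (2 : ℝ) ≤ l n := by exact_mod_cast hl2
  have hlpos : 0 < Real.log (l n) := Real.log_pos (by linarith)
  set X : ℝ := l n / Real.log (l n) with hX
  have hX1 : 1 ≤ X := by
    rw [hX, le_div_iff₀ hlpos, one_mul]
    exact Real.log_le_self (by linarith)
  have hbound := Dtree_alt_zero_le n hl2 hrank (by positivity)
  have hsucc : Real.log (n + 1 : ℕ) ≤ Real.log n + 1 := by
    have hnR : (1 : ℝ) ≤ n := by exact_mod_cast hn
    have h : ((n + 1 : ℕ) : ℝ) ≤ n * Real.exp 1 := by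
      push_cast
      nlinarith [Real.add_one_le_exp (1 : ℝ)]
    calc Real.log (n + 1 : ℕ) ≤ Real.log (n * Real.exp 1) :=
          Real.log_le_log (by positivity) h
      _ = Real.log n + 1 := by
          rw [Real.log_mul (by positivity) (by positivity), Real.log_exp]
  rw [div_le_iff₀ (half_pos hε)] at hlarge
  have h₁ : (1 + ε / 2) * X * Real.log (n + 1 : ℕ) ≤ (1 + ε / 2) * X * (Real.log n + 1) := by
    gcongr
  have h₂ : X * (3 + ε / 2) ≤ X * (Real.log n * (ε / 2)) := by gcongr
  have h₃ : (l n : ℝ) * Real.log n / Real.log (l n) = X * Real.log n := by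
    rw [hX]
    ring
  rw [h₃]
  linarith
end

section
/- There is a constant M such that for all n and all integers k with 1 ≤ k ≤ ln⁴ n, if F(n,k) is a uniformly random forest from F_{n,k} and L denotes the number of vertices of a largest tree of F(n,k), then E[n − L] ≤ M · k · √n; that is, the expected total number of vertices in all trees of F(n,k) other than a largest one is O(k √n). -/
namespace FODef

/-- `F` belongs to `F_{n,k}`: it is a forest on `{0, …, n-1}` consisting of `k` trees
rooted at the first `k` vertices, i.e. it is acyclic and each component contains exactly
one of the first `k` vertices (equivalently, every vertex is connected to exactly one
root). -/
def IsRootedForest (n k : ℕ) (F : SimpleGraph (Fin n)) : Prop :=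
  F.IsAcyclic ∧ ∀ v : Fin n, ∃! r : Fin n, r.val < k ∧ F.Reachable v r

open Classical in
/-- The probability of the event `E` for a forest chosen uniformly at random
from `F_{n,k}`. -/
noncomputable def rfProb (n k : ℕ) (E : Set (SimpleGraph (Fin n))) : ℝ :=
  ((Finset.univ.filter
      (fun F : SimpleGraph (Fin n) => IsRootedForest n k F ∧ F ∈ E)).card : ℝ) /
  ((Finset.univ.filter (fun F : SimpleGraph (Fin n) => IsRootedForest n k F)).card : ℝ)

open Classical in
/-- The expectation of `X` for a forest chosen uniformly at random from `F_{n,k}`. -/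
noncomputable def rfExp (n k : ℕ) (X : SimpleGraph (Fin n) → ℝ) : ℝ :=
  (∑ F ∈ Finset.univ.filter (fun F : SimpleGraph (Fin n) => IsRootedForest n k F), X F) /
  ((Finset.univ.filter (fun F : SimpleGraph (Fin n) => IsRootedForest n k F)).card : ℝ)

end FODef

namespace FODef

/-- The number of vertices of a largest connected component (largest tree) of `F`. -/
noncomputable def largestTree {n : ℕ} (F : SimpleGraph (Fin n)) : ℕ :=
  sSup {m | ∃ cc : F.ConnectedComponent, m = Nat.card cc.supp}

end FODef

open FODef

/-- `F` is acyclic and every vertex is connected to exactly one vertex of `R`. -/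
def IsForestRootedAt {V : Type*} (R : Finset V) (F : SimpleGraph V) : Prop :=
  F.IsAcyclic ∧ ∀ v : V, ∃! r : V, r ∈ R ∧ F.Reachable v r

theorem reachable_sup_edge_iff {V : Type*} (G : SimpleGraph V) (x y a b : V) :
    (G ⊔ SimpleGraph.edge x y).Reachable a b ↔
      G.Reachable a b ∨ (G.Reachable a x ∧ G.Reachable y b) ∨
        (G.Reachable a y ∧ G.Reachable x b) := by
  constructor
  · rintro ⟨p⟩
    induction p with
    | nil => exact Or.inl (SimpleGraph.Reachable.refl _)
    | @cons a c b h p ih =>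
      rw [SimpleGraph.sup_adj, SimpleGraph.edge_adj] at h
      rcases h with h | ⟨⟨rfl, rfl⟩ | ⟨rfl, rfl⟩, -⟩
      · have h := h.reachable
        rcases ih with ih | ⟨h1, h2⟩ | ⟨h1, h2⟩
        · exact Or.inl (h.trans ih)
        · exact Or.inr (Or.inl ⟨h.trans h1, h2⟩)
        · exact Or.inr (Or.inr ⟨h.trans h1, h2⟩)
      · rcases ih with ih | ⟨h1, h2⟩ | ⟨h1, h2⟩
        · exact Or.inr (Or.inl ⟨.refl _, ih⟩)
        · exact Or.inr (Or.inl ⟨.refl _, h2⟩)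
        · exact Or.inl h2
      · rcases ih with ih | ⟨h1, h2⟩ | ⟨h1, h2⟩
        · exact Or.inr (Or.inr ⟨.refl _, ih⟩)
        · exact Or.inl h2
        · exact Or.inr (Or.inr ⟨.refl _, h2⟩)
  · have hle : G ≤ G ⊔ SimpleGraph.edge x y := le_sup_left
    have hxy : (G ⊔ SimpleGraph.edge x y).Reachable x y := by
      by_cases h : x = y
      · rw [h]
      · exact SimpleGraph.Adj.reachable (by simp [SimpleGraph.edge_adj, h])
    rintro (h | ⟨h1, h2⟩ | ⟨h1, h2⟩)
    · exact h.mono hle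
    · exact ((h1.mono hle).trans hxy).trans (h2.mono hle)
    · exact ((h1.mono hle).trans hxy.symm).trans (h2.mono hle)

section RootedForest

theorem IsForestRootedAt.eq_of_reachable {V : Type*} {R : Finset V} {F : SimpleGraph V}
    (hF : IsForestRootedAt R F) {u r s : V} (hr : r ∈ R) (hs : s ∈ R)
    (hur : F.Reachable u r) (hus : F.Reachable u s) : r = s :=
  (hF.2 u).unique ⟨hr, hur⟩ ⟨hs, hus⟩

variable {V : Type*} [DecidableEq V] {R : Finset V} {v : V}

/-- A vertex outside the tree of the root `v` lies in the tree of another root. -/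
theorem IsForestRootedAt.exists_root_of_not_reachable {G : SimpleGraph V}
    (hG : IsForestRootedAt (insert v R) G) {w : V} (hw : ¬ G.Reachable w v) :
    ∃ r ∈ R, G.Reachable w r := by
  obtain ⟨r, ⟨hr, hwr⟩, -⟩ := hG.2 w
  rcases Finset.mem_insert.1 hr with rfl | hr
  · exact absurd hwr hw
  · exact ⟨r, hr, hwr⟩

/-- Attaching the root `v` to a vertex of another tree demotes `v` to a non-root. -/
theorem IsForestRootedAt.sup_edge (hv : v ∉ R) {G : SimpleGraph V}
    (hG : IsForestRootedAt (insert v R) G) {w : V} (hw : ¬ G.Reachable w v) :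
    IsForestRootedAt R (G ⊔ SimpleGraph.edge v w) := by
  have hvR : ∀ s ∈ R, ¬ G.Reachable v s := fun s hs h => hv <| by
    rwa [hG.eq_of_reachable (Finset.mem_insert_self v R) (Finset.mem_insert_of_mem hs)
      (.refl v) h]
  refine ⟨hG.1.sup_edge_of_not_reachable fun h => hw h.symm, fun u => ?_⟩
  simp only [reachable_sup_edge_iff]
  have key : ∀ s ∈ R, ∀ t ∈ R, ∀ x, G.Reachable x s → G.Reachable x t → s = t :=
    fun s hs t ht x h1 h2 => hG.eq_of_reachable (Finset.mem_insert_of_mem hs)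
      (Finset.mem_insert_of_mem ht) h1 h2
  obtain ⟨r, hr, hwr⟩ := hG.exists_root_of_not_reachable hw
  by_cases huv : G.Reachable u v
  · refine ⟨r, ⟨hr, Or.inr (Or.inl ⟨huv, hwr⟩)⟩, ?_⟩
    rintro s ⟨hs, h | ⟨-, h⟩ | ⟨-, h⟩⟩
    · exact absurd (huv.symm.trans h) (hvR s hs)
    · exact key s hs r hr w h hwr
    · exact absurd h (hvR s hs)
  · obtain ⟨t, ht, hut⟩ := hG.exists_root_of_not_reachable huv
    refine ⟨t, ⟨ht, Or.inl hut⟩, ?_⟩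
    rintro s ⟨hs, h | ⟨h, -⟩ | ⟨-, h⟩⟩
    · exact key s hs t ht u h hut
    · exact absurd h huv
    · exact absurd h (hvR s hs)

/-- A forest in which `v` is not a root arises by attaching `v` to another tree. -/
theorem IsForestRootedAt.exists_eq_sup_edge (hv : v ∉ R) {F : SimpleGraph V}
    (hF : IsForestRootedAt R F) :
    ∃ (G : SimpleGraph V) (w : V), IsForestRootedAt (insert v R) G ∧ ¬ G.Reachable w v ∧
      G ⊔ SimpleGraph.edge v w = F := by
  obtain ⟨r, ⟨hr, hvr⟩, -⟩ := hF.2 v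
  obtain ⟨p, hp⟩ := hvr.exists_isPath
  cases p with
  | nil => exact absurd hr hv
  | @cons _ w _ hvw q =>
  rw [SimpleGraph.Walk.cons_isPath_iff] at hp
  set G := F.deleteEdges {s(v, w)} with hGdef
  have hle : G ≤ F := SimpleGraph.deleteEdges_le _
  have hFG : G ⊔ SimpleGraph.edge v w = F := by
    ext a b
    simp only [hGdef, SimpleGraph.sup_adj, SimpleGraph.deleteEdges_adj, SimpleGraph.edge_adj,
      Set.mem_singleton_iff, Sym2.eq_iff]
    constructor
    · rintro (h | ⟨⟨rfl, rfl⟩ | ⟨rfl, rfl⟩, -⟩)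
      exacts [h.1, hvw, hvw.symm]
    · intro h
      by_cases h' : a = v ∧ b = w ∨ a = w ∧ b = v
      · exact Or.inr ⟨h', h.ne⟩
      · exact Or.inl ⟨h, h'⟩
  have hnvw : ¬ G.Reachable v w :=
    SimpleGraph.isBridge_iff.1 (SimpleGraph.isAcyclic_iff_forall_isBridge.1 hF.1 hvw)
  have hwr : G.Reachable w r := ⟨q.toDeleteEdge s(v, w) fun h =>
    hp.2 (SimpleGraph.Walk.fst_mem_support_of_mem_edges q h)⟩
  have hvR : ∀ s ∈ R, ¬ G.Reachable v s := by
    intro s hs h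
    have := hF.eq_of_reachable hr hs hvr (h.mono hle)
    subst this
    exact hnvw (h.trans hwr.symm)
  refine ⟨G, w, ⟨hF.1.anti hle, fun u => ?_⟩, fun h => hnvw h.symm, hFG⟩
  apply existsUnique_of_exists_of_unique
  · obtain ⟨s, ⟨hs, hus⟩, -⟩ := hF.2 u
    rw [← hFG, reachable_sup_edge_iff] at hus
    rcases hus with h | ⟨h, -⟩ | ⟨h, -⟩
    · exact ⟨s, Finset.mem_insert_of_mem hs, h⟩
    · exact ⟨v, Finset.mem_insert_self v R, h⟩
    · exact ⟨r, Finset.mem_insert_of_mem hr, h.trans hwr⟩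
  · rintro s t ⟨hs, hus⟩ ⟨ht, hut⟩
    rw [Finset.mem_insert] at hs ht
    obtain rfl | hs := hs <;> obtain rfl | ht := ht
    · rfl
    · exact absurd (hus.symm.trans hut) (hvR t ht)
    · exact absurd (hut.symm.trans hus) (hvR s hs)
    · exact hF.eq_of_reachable hs ht (hus.mono hle) (hut.mono hle)

/-- The forest and the vertex to which `v` is attached are determined by the result. -/
theorem IsForestRootedAt.sup_edge_injective (hv : v ∉ R) {G G' : SimpleGraph V}
    (hG : IsForestRootedAt (insert v R) G) (hG' : IsForestRootedAt (insert v R) G') {w w' : V}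
    (hw : ¬ G.Reachable w v) (hw' : ¬ G'.Reachable w' v)
    (h : G ⊔ SimpleGraph.edge v w = G' ⊔ SimpleGraph.edge v w') : G = G' ∧ w = w' := by
  have hF := hG.sup_edge hv hw
  have path : ∀ {H : SimpleGraph V} {x : V}, IsForestRootedAt (insert v R) H →
      ¬ H.Reachable x v → G ⊔ SimpleGraph.edge v w = H ⊔ SimpleGraph.edge v x →
      ∃ r ∈ R, ∃ p : (G ⊔ SimpleGraph.edge v w).Walk v r, p.IsPath ∧ p.snd = x := by
    intro H x hH hx hGH
    obtain ⟨r, hr, hxr⟩ := hH.exists_root_of_not_reachable hx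
    obtain ⟨q, hq⟩ := hxr.exists_isPath
    have hvx : v ≠ x := fun h => hx (h ▸ .refl _)
    have hadj : (G ⊔ SimpleGraph.edge v w).Adj v x := by
      rw [hGH]; simp [SimpleGraph.edge_adj, hvx]
    have hle : H ≤ G ⊔ SimpleGraph.edge v w := by rw [hGH]; exact le_sup_left
    refine ⟨r, hr, .cons hadj (q.mapLe hle), ?_, by simp⟩
    rw [SimpleGraph.Walk.cons_isPath_iff]
    refine ⟨hq.mapLe hle, fun hm => hx ?_⟩
    rw [SimpleGraph.Walk.support_mapLe_eq_support] at hm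
    exact ⟨q.takeUntil v hm⟩
  obtain ⟨r, hr, p, hp, hpw⟩ := path hG hw rfl
  obtain ⟨r', hr', p', hp', hpw'⟩ := path hG' hw' h
  obtain rfl := hF.eq_of_reachable hr hr' ⟨p⟩ ⟨p'⟩
  have hpp : p = p' := congrArg Subtype.val
    ((hF.1.subsingleton_path v r).elim ⟨p, hp⟩ ⟨p', hp'⟩)
  have hww : w = w' := by rw [← hpw, ← hpw', hpp]
  subst hww
  have sdiff_eq : ∀ {H : SimpleGraph V}, ¬ H.Reachable w v →
      (H ⊔ SimpleGraph.edge v w) \ SimpleGraph.edge v w = H := fun {H} hH => by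
    rw [sup_sdiff_right_self]
    exact H.sdiff_edge fun h => hH h.symm.reachable
  exact ⟨by rw [← sdiff_eq hw, h, sdiff_eq hw'], rfl⟩

end RootedForest

theorem reachable_comap_iff {V : Type*} (σ : Equiv.Perm V) (G : SimpleGraph V) (a b : V) :
    (G.comap σ).Reachable a b ↔ G.Reachable (σ a) (σ b) :=
  (SimpleGraph.Iso.comap σ G).reachable_iff.symm

theorem IsForestRootedAt.comap {V : Type*} {S : Finset V} {σ : Equiv.Perm V}
    (hσ : ∀ a, σ a ∈ S ↔ a ∈ S)
    {G : SimpleGraph V} (hG : IsForestRootedAt S G) : IsForestRootedAt S (G.comap σ) := by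
  refine ⟨(SimpleGraph.Iso.comap σ G).isAcyclic_iff.2 hG.1, fun v => ?_⟩
  rw [σ.existsUnique_congr (q := fun r => r ∈ S ∧ G.Reachable (σ v) r)
    fun {r} => by rw [reachable_comap_iff, hσ]]
  exact hG.2 (σ v)

section Counting

open Classical

variable {V : Type*} [Fintype V]

/-- The finite set of all forests on `V` with root set `R`. -/
noncomputable def rootedForests (R : Finset V) : Finset (SimpleGraph V) :=
  Finset.univ.filter (IsForestRootedAt R)

/-- The number of vertices outside the component of `v`. -/
noncomputable def separated (G : SimpleGraph V) (v : V) : ℕ :=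
  (Finset.univ.filter fun u => ¬ G.Reachable u v).card

/-- The number of ordered pairs of vertices such that the two vertices and `v` lie in three
different components. -/
noncomputable def separatedPairs (G : SimpleGraph V) (v : V) : ℕ :=
  (Finset.univ.filter fun p : V × V =>
    ¬ G.Reachable p.1 v ∧ ¬ G.Reachable p.2 v ∧ ¬ G.Reachable p.2 p.1).card

theorem mem_rootedForests {R : Finset V} {F : SimpleGraph V} :
    F ∈ rootedForests R ↔ IsForestRootedAt R F := by
  simp [rootedForests]

theorem sum_rootedForests {R : Finset V} {v : V} (hv : v ∉ R) (f : SimpleGraph V → ℕ) :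
    ∑ F ∈ rootedForests R, f F = ∑ G ∈ rootedForests (insert v R),
      ∑ w with ¬ G.Reachable w v, f (G ⊔ SimpleGraph.edge v w) := by
  rw [Finset.sum_sigma', eq_comm]
  refine Finset.sum_bij (fun p _ => p.1 ⊔ SimpleGraph.edge v p.2) ?_ ?_ ?_ fun _ _ => rfl
  · rintro ⟨G, w⟩ h
    simp only [Finset.mem_sigma, mem_rootedForests, Finset.mem_filter_univ] at h
    exact mem_rootedForests.2 (h.1.sup_edge hv h.2)
  · rintro ⟨G, w⟩ h ⟨G', w'⟩ h' heq
    simp only [Finset.mem_sigma, mem_rootedForests, Finset.mem_filter_univ] at h h'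
    obtain ⟨rfl, rfl⟩ := h.1.sup_edge_injective hv h'.1 h.2 h'.2 heq
    rfl
  · intro F hF
    obtain ⟨G, w, hG, hw, h⟩ := (mem_rootedForests.1 hF).exists_eq_sup_edge hv
    exact ⟨⟨G, w⟩, by simp [mem_rootedForests, hG, hw], h⟩

theorem card_rootedForests_eq {R : Finset V} {v : V} (hv : v ∉ R) :
    (rootedForests R).card = ∑ G ∈ rootedForests (insert v R), separated G v := by
  rw [Finset.card_eq_sum_ones, sum_rootedForests hv]
  simp [separated]

theorem sum_separated_eq {R : Finset V} {v : V} (hv : v ∉ R) :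
    ∑ F ∈ rootedForests R, separated F v =
      ∑ G ∈ rootedForests (insert v R), separatedPairs G v := by
  rw [sum_rootedForests hv]
  refine Finset.sum_congr rfl fun G _ => ?_
  simp only [separated, separatedPairs]
  rw [← Finset.card_sigma]
  refine Finset.card_bij' (fun p _ => (p.1, p.2)) (fun p _ => ⟨p.1, p.2⟩) ?_ ?_ ?_ ?_
  · rintro ⟨w, u⟩ h
    simp only [Finset.mem_sigma, Finset.mem_filter_univ, reachable_sup_edge_iff] at h ⊢
    refine ⟨h.1, fun h' => h.2 (Or.inl h'), fun h' => h.2 (Or.inr (Or.inr ⟨h', .refl _⟩))⟩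
  · rintro ⟨w, u⟩ h
    simp only [Finset.mem_sigma, Finset.mem_filter_univ, reachable_sup_edge_iff] at h ⊢
    refine ⟨h.1, ?_⟩
    rintro (h' | ⟨h', -⟩ | ⟨h', -⟩)
    exacts [h.2.1 h', h.2.1 h', h.2.2 h']
  · intros; rfl
  · intros; rfl

theorem separated_comap (σ : Equiv.Perm V) (G : SimpleGraph V) (v : V) :
    separated (G.comap σ) v = separated G (σ v) :=
  Finset.card_equiv σ fun u => by simp [reachable_comap_iff]

theorem separatedPairs_comap (σ : Equiv.Perm V) (G : SimpleGraph V) (v : V) :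
    separatedPairs (G.comap σ) v = separatedPairs G (σ v) :=
  Finset.card_equiv (σ.prodCongr σ) fun p => by simp [reachable_comap_iff]

/-- All roots play the same role. -/
theorem sum_rootedForests_root_eq {S : Finset V} (f : SimpleGraph V → V → ℕ)
    (hf : ∀ (σ : Equiv.Perm V) G v, f (G.comap σ) v = f G (σ v)) {r s : V}
    (hr : r ∈ S) (hs : s ∈ S) :
    ∑ G ∈ rootedForests S, f G r = ∑ G ∈ rootedForests S, f G s := by
  have hσ : ∀ a, Equiv.swap r s a ∈ S ↔ a ∈ S := fun a => by
    rw [Equiv.swap_apply_def]; grind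
  have hmem : ∀ G ∈ rootedForests S, G.comap (Equiv.swap r s) ∈ rootedForests S :=
    fun G hG => mem_rootedForests.2 ((mem_rootedForests.1 hG).comap hσ)
  have hinv : ∀ G : SimpleGraph V, (G.comap (Equiv.swap r s)).comap (Equiv.swap r s) = G :=
    fun G => by ext a b; simp
  refine Finset.sum_bij' (fun G _ => G.comap (Equiv.swap r s))
    (fun G _ => G.comap (Equiv.swap r s)) hmem hmem (fun G _ => hinv G) (fun G _ => hinv G)
    fun G _ => ?_
  rw [hf, Equiv.swap_apply_right]

theorem card_mul_sum_rootedForests {S : Finset V} (f : SimpleGraph V → V → ℕ)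
    (hf : ∀ (σ : Equiv.Perm V) G v, f (G.comap σ) v = f G (σ v)) {r : V} (hr : r ∈ S) :
    S.card * ∑ G ∈ rootedForests S, f G r = ∑ G ∈ rootedForests S, ∑ s ∈ S, f G s := by
  rw [Finset.sum_comm, ← smul_eq_mul]
  exact (Finset.sum_eq_card_nsmul fun s hs => sum_rootedForests_root_eq f hf hs hr).symm

theorem IsForestRootedAt.card_roots_reachable {S : Finset V} {G : SimpleGraph V}
    (hG : IsForestRootedAt S G) (u : V) : (S.filter fun r => G.Reachable u r).card = 1 := by
  obtain ⟨r, hr, h⟩ := hG.2 u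
  refine Finset.card_eq_one.2 ⟨r, ?_⟩
  ext s
  simp only [Finset.mem_filter, Finset.mem_singleton]
  exact ⟨fun hs => h s hs, fun hs => hs ▸ hr⟩

theorem IsForestRootedAt.sum_separated {S : Finset V} {k : ℕ} (hS : S.card = k + 1)
    {G : SimpleGraph V} (hG : IsForestRootedAt S G) :
    ∑ r ∈ S, separated G r = Fintype.card V * k := by
  simp only [separated, Finset.card_filter]
  rw [Finset.sum_comm, ← smul_eq_mul, ← Finset.card_univ]
  refine Finset.sum_eq_card_nsmul fun u _ => ?_
  rw [← Finset.card_filter]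
  have h := S.card_filter_add_card_filter_not fun r => G.Reachable u r
  rw [hG.card_roots_reachable u] at h
  omega

theorem IsForestRootedAt.sum_separatedPairs {S : Finset V} {k : ℕ} (hS : S.card = k + 2)
    {G : SimpleGraph V} (hG : IsForestRootedAt S G) :
    ∑ r ∈ S, separatedPairs G r = k * ∑ u, separated G u := by
  have hpairs : ∑ u, separated G u =
      (Finset.univ.filter fun p : V × V => ¬ G.Reachable p.2 p.1).card := by
    simp only [separated]
    rw [Finset.card_filter, Fintype.sum_prod_type]
    simp only [Finset.card_filter]
  rw [hpairs, mul_comm, ← smul_eq_mul]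
  simp only [separatedPairs, Finset.card_filter (fun p : V × V => _ ∧ _)]
  rw [Finset.sum_comm]
  simp only [← Finset.card_filter]
  rw [← Finset.sum_filter_add_sum_filter_not _ fun p : V × V => ¬ G.Reachable p.2 p.1]
  rw [Finset.sum_eq_card_nsmul (b := k), add_eq_left]
  · refine Finset.sum_eq_zero fun p hp => ?_
    rw [Finset.mem_filter_univ] at hp
    exact Finset.card_eq_zero.2 (Finset.filter_eq_empty_iff.2 fun r _ h => hp h.2.2)
  · intro p hp
    rw [Finset.mem_filter_univ] at hp
    have h := S.card_filter_add_card_filter_not fun r => G.Reachable p.1 r ∨ G.Reachable p.2 r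
    have hdisj : Disjoint (S.filter fun r => G.Reachable p.1 r)
        (S.filter fun r => G.Reachable p.2 r) :=
      Finset.disjoint_filter.2 fun r _ h1 h2 => hp (h2.trans h1.symm)
    rw [Finset.filter_or, Finset.card_union_of_disjoint hdisj, hG.card_roots_reachable,
      hG.card_roots_reachable] at h
    have heq : (S.filter fun r => ¬ G.Reachable p.1 r ∧ ¬ G.Reachable p.2 r ∧
        ¬ G.Reachable p.2 p.1) = S.filter fun r => ¬ (G.Reachable p.1 r ∨ G.Reachable p.2 r) :=
      Finset.filter_congr fun r _ => by tauto
    rw [heq]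
    omega

theorem card_rootedForests_insert {R : Finset V} {k : ℕ} (hR : R.card = k) {v : V}
    (hv : v ∉ R) :
    (k + 1) * (rootedForests R).card =
      Fintype.card V * k * (rootedForests (insert v R)).card := by
  have hS : (insert v R).card = k + 1 := by rw [Finset.card_insert_of_notMem hv, hR]
  rw [card_rootedForests_eq hv, ← hS,
    card_mul_sum_rootedForests _ separated_comap (Finset.mem_insert_self v R),
    mul_comm _ (Finset.card _), ← smul_eq_mul]
  exact Finset.sum_eq_card_nsmul fun G hG => (mem_rootedForests.1 hG).sum_separated hS

theorem sum_separated_insert {R : Finset V} {k : ℕ} (hR : R.card = k + 1) {v : V}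
    (hv : v ∉ R) :
    (k + 2) * ∑ F ∈ rootedForests R, separated F v =
      k * ∑ u, ∑ G ∈ rootedForests (insert v R), separated G u := by
  have hS : (insert v R).card = k + 2 := by rw [Finset.card_insert_of_notMem hv, hR]
  rw [sum_separated_eq hv, ← hS,
    card_mul_sum_rootedForests _ separatedPairs_comap (Finset.mem_insert_self v R),
    Finset.sum_comm (s := Finset.univ), Finset.mul_sum]
  exact Finset.sum_congr rfl fun G hG => (mem_rootedForests.1 hG).sum_separatedPairs hS

/-- One step of the recursion from `k + 2` roots to `k + 1` roots. -/
theorem sum_separated_le_step {k : ℕ} {c : ℝ} (hc : 0 ≤ c)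
    (h : ∀ S : Finset V, S.card = k + 2 → ∀ u ∉ S,
      ((∑ G ∈ rootedForests S, separated G u : ℕ) : ℝ) ≤
        (k + 1) * c * (rootedForests S).card)
    {R : Finset V} (hR : R.card = k + 1) {v : V} (hv : v ∉ R) :
    ((∑ F ∈ rootedForests R, separated F v : ℕ) : ℝ) ≤
      k * (c + 1) * (rootedForests R).card := by
  have hS : (insert v R).card = k + 2 := by rw [Finset.card_insert_of_notMem hv, hR]
  have h1 : ((k : ℝ) + 2) * (rootedForests R).card =
      Fintype.card V * (k + 1) * (rootedForests (insert v R)).card := by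
    exact_mod_cast card_rootedForests_insert hR hv
  have h2 : ((k : ℝ) + 2) * (∑ F ∈ rootedForests R, separated F v : ℕ) =
      k * ∑ u, ((∑ G ∈ rootedForests (insert v R), separated G u : ℕ) : ℝ) := by
    exact_mod_cast sum_separated_insert hR hv
  have hroots : ∑ u ∈ insert v R,
      ((∑ G ∈ rootedForests (insert v R), separated G u : ℕ) : ℝ) =
        (k + 2) * (rootedForests R).card := by
    rw [Finset.sum_eq_card_nsmul (b := ((rootedForests R).card : ℝ)), hS]
    · push_cast [nsmul_eq_mul]; ring
    · intro u hu
      rw [card_rootedForests_eq hv, sum_rootedForests_root_eq _ separated_comap hu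
        (Finset.mem_insert_self v R)]
  have hnonroots : ∑ u ∈ (insert v R)ᶜ,
      ((∑ G ∈ rootedForests (insert v R), separated G u : ℕ) : ℝ) ≤
        (k + 2) * (rootedForests R).card * c := by
    calc _ ≤ ∑ u ∈ (insert v R)ᶜ, ((k : ℝ) + 1) * c * (rootedForests (insert v R)).card :=
          Finset.sum_le_sum fun u hu => h _ hS u (Finset.mem_compl.1 hu)
      _ ≤ ∑ u : V, ((k : ℝ) + 1) * c * (rootedForests (insert v R)).card :=
          Finset.sum_le_univ_sum_of_nonneg fun _ => by positivity
      _ = _ := by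
          rw [h1, Finset.sum_const, Finset.card_univ, nsmul_eq_mul]; ring
  rw [← Finset.sum_add_sum_compl (insert v R), hroots] at h2
  have hk : (0 : ℝ) < k + 2 := by positivity
  refine le_of_mul_le_mul_left ?_ hk
  rw [h2]
  calc _ ≤ (k : ℝ) * ((k + 2) * (rootedForests R).card +
        (k + 2) * (rootedForests R).card * c) := by gcongr
    _ = _ := by ring

theorem sum_separated_le (d : ℕ) : ∀ k : ℕ, 0 < k + d → ∀ R : Finset V, R.card = k + 1 →
    ∀ v ∉ R, ((∑ F ∈ rootedForests R, separated F v : ℕ) : ℝ) ≤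
      k * (Fintype.card V / (k + d) + d) * (rootedForests R).card := by
  induction d with
  | zero =>
    intro k hk R _ v _
    have hk' : (k : ℝ) ≠ 0 := by exact_mod_cast (by omega : k ≠ 0)
    have : ∑ F ∈ rootedForests R, separated F v ≤ (rootedForests R).card • Fintype.card V :=
      Finset.sum_le_card_nsmul _ _ _ fun F _ => Finset.card_le_univ _
    calc _ ≤ (((rootedForests R).card • Fintype.card V : ℕ) : ℝ) := by exact_mod_cast this
      _ = _ := by push_cast [smul_eq_mul]; field_simp; ring
  | succ d ih =>
    intro k _ R hR v hv
    have hstep := sum_separated_le_step (V := V) (k := k)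
      (c := Fintype.card V / (k + 1 + d) + d) (by positivity)
      (fun S hS u hu => by simpa using ih (k + 1) (by omega) S hS u hu) hR hv
    refine hstep.trans_eq ?_
    push_cast
    ring

/-- In a uniformly random forest with `k + 1` roots, the expected number of vertices outside
the tree of a fixed non-root vertex is at most `3 k √n`. -/
theorem sum_separated_le_sqrt {k : ℕ} {R : Finset V} (hR : R.card = k + 1) {v : V}
    (hv : v ∉ R) :
    ((∑ F ∈ rootedForests R, separated F v : ℕ) : ℝ) ≤
      3 * k * Real.sqrt (Fintype.card V) * (rootedForests R).card := by
  have hn : (1 : ℝ) ≤ Fintype.card V := by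
    exact_mod_cast Fintype.card_pos_iff.2 ⟨v⟩
  have hs : 1 ≤ Real.sqrt (Fintype.card V) := Real.one_le_sqrt.2 hn
  set d := ⌈Real.sqrt (Fintype.card V)⌉₊
  have hd : Real.sqrt (Fintype.card V) ≤ d := Nat.le_ceil _
  have hd' : (d : ℝ) < Real.sqrt (Fintype.card V) + 1 := Nat.ceil_lt_add_one (by positivity)
  have hd0 : 0 < k + d := by
    have : (0 : ℝ) < d := by linarith
    have : 0 < d := by exact_mod_cast this
    omega
  have hdiv : (Fintype.card V : ℝ) / (k + d) ≤ Real.sqrt (Fintype.card V) := by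
    rw [div_le_iff₀ (by exact_mod_cast hd0)]
    calc (Fintype.card V : ℝ) = Real.sqrt (Fintype.card V) * Real.sqrt (Fintype.card V) :=
          (Real.mul_self_sqrt (by positivity)).symm
      _ ≤ _ := by gcongr; linarith [Nat.cast_nonneg (α := ℝ) k]
  refine (sum_separated_le d k hd0 R hR v hv).trans ?_
  calc _ ≤ (k : ℝ) * (3 * Real.sqrt (Fintype.card V)) * (rootedForests R).card := by
        gcongr; linarith
    _ = _ := by ring

end Counting

namespace FODef

theorem sub_largestTree_le_separated {n : ℕ} (F : SimpleGraph (Fin n)) (v : Fin n) :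
    (n : ℝ) - largestTree F ≤ separated F v := by
  classical
  have hle : Nat.card (F.connectedComponentMk v).supp ≤ largestTree F := by
    refine le_csSup ⟨n, ?_⟩ ⟨_, rfl⟩
    rintro m ⟨cc, rfl⟩
    exact (Finite.card_subtype_le _).trans_eq (Nat.card_fin n)
  have hcard : Nat.card (F.connectedComponentMk v).supp =
      (Finset.univ.filter fun u => F.Reachable u v).card := by
    rw [Nat.card_eq_fintype_card, Fintype.card_subtype]
    simp
  have hsum := (Finset.univ : Finset (Fin n)).card_filter_add_card_filter_not
    fun u => F.Reachable u v
  have hn : n ≤ largestTree F + separated F v := by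
    rw [Finset.card_univ, Fintype.card_fin, ← hcard] at hsum
    have hsep : separated F v = (Finset.univ.filter fun u => ¬ F.Reachable u v).card := by
      unfold separated
      congr
    omega
  have : (n : ℝ) ≤ largestTree F + separated F v := by exact_mod_cast hn
  linarith

theorem rfExp_eq (n k : ℕ) (X : SimpleGraph (Fin n) → ℝ) :
    rfExp n k X = (∑ F ∈ rootedForests (Finset.univ.filter fun r : Fin n => r.val < k), X F) /
      (rootedForests (Finset.univ.filter fun r : Fin n => r.val < k)).card := by
  classical
  have h : rootedForests (Finset.univ.filter fun r : Fin n => r.val < k) =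
      Finset.univ.filter fun F : SimpleGraph (Fin n) => IsRootedForest n k F := by
    ext F
    rw [mem_rootedForests, Finset.mem_filter_univ]
    simp [IsForestRootedAt, IsRootedForest]
  rw [h]
  unfold rfExp
  convert rfl

theorem rfExp_le_of_sum_le {n k : ℕ} {X : SimpleGraph (Fin n) → ℝ} {c : ℝ} (hc : 0 ≤ c)
    (h : ∑ F ∈ rootedForests (Finset.univ.filter fun r : Fin n => r.val < k), X F ≤
      c * (rootedForests (Finset.univ.filter fun r : Fin n => r.val < k)).card) :
    rfExp n k X ≤ c := by
  rw [rfExp_eq]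
  exact div_le_of_le_mul₀ (Nat.cast_nonneg _) hc h

end FODef

theorem statement15 :
    ∃ M : ℝ, ∀ n k : ℕ, 1 ≤ k → (k : ℝ) ≤ Real.log n ^ 4 →
      rfExp n k (fun F => (n : ℝ) - (largestTree F : ℝ)) ≤ M * k * Real.sqrt n := by
  refine ⟨3, fun n k hk _ => ?_⟩
  rcases le_or_gt n k with hnk | hkn
  · refine rfExp_le_of_sum_le (by positivity) ?_
    rw [mul_comm, ← nsmul_eq_mul]
    refine Finset.sum_le_card_nsmul _ _ _ fun F _ => ?_
    rcases Nat.eq_zero_or_pos n with rfl | hn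
    · simp
    have hs : 1 ≤ Real.sqrt n := Real.one_le_sqrt.2 (by exact_mod_cast hn)
    have hnk' : (n : ℝ) ≤ k := by exact_mod_cast hnk
    have hL : (0 : ℝ) ≤ largestTree F := Nat.cast_nonneg _
    nlinarith
  · obtain ⟨k, rfl⟩ := Nat.exists_eq_add_of_le' hk
    have hcard : (Finset.univ.filter fun r : Fin n => r.val < k + 1).card = k + 1 := by
      rw [Fin.card_filter_val_lt]; omega
    have hv : (⟨k + 1, hkn⟩ : Fin n) ∉ Finset.univ.filter fun r : Fin n => r.val < k + 1 := by
      simp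
    refine rfExp_le_of_sum_le (by positivity) ?_
    have h := sum_separated_le_sqrt hcard hv
    rw [Fintype.card_fin] at h
    push_cast at h ⊢
    calc _ ≤ _ := Finset.sum_le_sum fun F _ => sub_largestTree_le_separated F ⟨k + 1, hkn⟩
      _ ≤ _ := h
      _ ≤ _ := by gcongr; linarith
end
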